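/- There exist constants c > 0 and C > 0 such that for every ε > 0 there exists n₀ with the following property. For all n ≥ n₀, all integers d with (log n)² ≤ d ≤ n^{1/2} and nd even, all integers dsos with 2 ≤ dsos ≤ d^{1/10}, setting p = d/n and D_V = ⌈C · dsos · log n⌉, and all k with 0 < k ≤ n/(√d · dsos^{c} · log n): with probability at least 1 − ε over G ∼ G_d(n), Σ_{i=1}^{n} Λ_{{i}}(G) ≥ (1−ε)·k, where Λ_{{i}}(G) = Σ_R (k/n)^{|V(R) ∪ {i}|} · ( −√(p/(1−p)) )^{|R|} · ∏_{e∈R} χ_e(G), the sum over all sets R of potential edges on {1,…,n} such that every connected component of the graph (V(R), R) contains the vertex i and |V(R) ∪ {i}| ≤ D_V. That is, the pseudo-calibrated pseudo-expectation attains objective value Σ_i Ẽ[x_i] ≥ (1−o(1))k with high probability over a uniformly random d-regular graph. -/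

import Mathlib

open scoped Classical

noncomputable section

namespace GM

/-- A graph on vertex set `Fin n`, given as a finite set of (potential) edges. -/
abbrev Graph (n : ℕ) := Finset (Sym2 (Fin n))

/-- The edge set contains no self-loops. -/
def IsSimpleG {n : ℕ} (G : Graph n) : Prop := ∀ e ∈ G, ¬ e.IsDiag

/-- Degree of a vertex. -/
def degree {n : ℕ} (G : Graph n) (v : Fin n) : ℕ := (G.filter (fun e => v ∈ e)).card

/-- The set of simple `d`-regular graphs on `n` vertices. -/
def regularGraphs (n d : ℕ) : Finset (Graph n) :=
  Finset.univ.filter (fun G => IsSimpleG G ∧ ∀ v, degree G v = d)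

/-- Expectation of `f` under the uniform distribution on `d`-regular graphs. -/
def regExp (n d : ℕ) (f : Graph n → ℝ) : ℝ :=
  (∑ G ∈ regularGraphs n d, f G) / (regularGraphs n d).card

/-- Probability of `P` under the uniform distribution on `d`-regular graphs. -/
def regPr (n d : ℕ) (P : Graph n → Prop) : ℝ :=
  (((regularGraphs n d).filter P).card : ℝ) / (regularGraphs n d).card

/-- The `p`-biased edge character. -/
def char {n : ℕ} (p : ℝ) (G : Graph n) (e : Sym2 (Fin n)) : ℝ :=
  if e ∈ G then Real.sqrt ((1 - p) / p) else - Real.sqrt (p / (1 - p))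

/-- A shape: a simple graph on `Fin m` with ordered tuples of distinct boundary vertices. -/
structure Shape where
  m : ℕ
  edges : Finset (Sym2 (Fin m))
  simple : ∀ e ∈ edges, ¬ e.IsDiag
  a : ℕ
  b : ℕ
  U : Fin a → Fin m
  V : Fin b → Fin m
  injU : Function.Injective U
  injV : Function.Injective V

/-- The simple graph underlying a shape. -/
def Shape.graph (τ : Shape) : SimpleGraph (Fin τ.m) :=
  SimpleGraph.fromEdgeSet (τ.edges : Set (Sym2 (Fin τ.m)))

/-- The boundary vertices of a shape. -/
def Shape.boundary (τ : Shape) : Finset (Fin τ.m) :=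
  Finset.univ.image τ.U ∪ Finset.univ.image τ.V

/-- The graph matrix of a shape, evaluated on a graph `G` with `p`-biased characters. -/
def graphMatrix (τ : Shape) (n : ℕ) (p : ℝ) (G : Graph n) :
    Matrix (Fin τ.a → Fin n) (Fin τ.b → Fin n) ℝ :=
  Matrix.of fun A B =>
    ∑ ψ ∈ Finset.univ.filter (fun ψ : Fin τ.m → Fin n =>
        Function.Injective ψ ∧ (∀ i, ψ (τ.U i) = A i) ∧ (∀ j, ψ (τ.V j) = B j)),
      ∏ e ∈ τ.edges, char p G (e.map ψ)

/-- `S` is a vertex separator of the shape `τ`: every path from the left boundary to the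
right boundary contains a vertex of `S`. -/
def IsSeparator (τ : Shape) (S : Finset (Fin τ.m)) : Prop :=
  ∀ (i : Fin τ.a) (j : Fin τ.b) (w : τ.graph.Walk (τ.U i) (τ.V j)),
    w.IsPath → ∃ v ∈ w.support, v ∈ S

/-- The set of edges of `τ` with both endpoints in `S`. -/
def edgesIn (τ : Shape) (S : Finset (Fin τ.m)) : Finset (Sym2 (Fin τ.m)) :=
  τ.edges.filter (fun e => ∀ v ∈ e, v ∈ S)

/-- Isolated vertices: vertices outside the boundary incident to no edge. -/
def isolatedVerts (τ : Shape) : Finset (Fin τ.m) :=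
  Finset.univ.filter (fun v => v ∉ τ.boundary ∧ ∀ e ∈ τ.edges, v ∉ e)

/-- `C` is the vertex set of a connected component of `τ`. -/
def IsComponent (τ : Shape) (C : Finset (Fin τ.m)) : Prop :=
  ∃ v, C = Finset.univ.filter (fun w => τ.graph.Reachable v w)

/-- `C` is a floating component of `τ`: an edge-induced connected component with no path
to the boundary. -/
def IsFloating (τ : Shape) (C : Finset (Fin τ.m)) : Prop :=
  IsComponent τ C ∧ (∃ e ∈ τ.edges, ∀ v ∈ e, v ∈ C) ∧
    ∀ v ∈ C, ∀ w ∈ τ.boundary, ¬ τ.graph.Reachable v w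

/-- A component is tree-like if `|V(C)| = |E(C)| + 1`. -/
def TreeLike (τ : Shape) (C : Finset (Fin τ.m)) : Prop :=
  C.card = (edgesIn τ C).card + 1

/-- The number of tree-like floating components of `τ` having no path to `S`. -/
def floatTreeCount (τ : Shape) (S : Finset (Fin τ.m)) : ℕ :=
  (Finset.univ.filter (fun C : Finset (Fin τ.m) =>
    IsFloating τ C ∧ TreeLike τ C ∧ ∀ v ∈ C, ∀ s ∈ S, ¬ τ.graph.Reachable v s)).card

/-- The block-value bound `B_q(τ)` (version with floating-component factor). -/
def Bq (τ : Shape) (n q : ℕ) (p cnorm : ℝ) : ℝ :=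
  sSup { x : ℝ | ∃ S : Finset (Fin τ.m), IsSeparator τ S ∧
    x = (Real.sqrt n * q) ^ (Finset.univ \ S).card
        * Real.sqrt ((1 - p) / p) ^ (edgesIn τ S).card
        * Real.sqrt n ^ (isolatedVerts τ).card
        * Real.sqrt n ^ floatTreeCount τ S
        * cnorm ^ τ.edges.card }

/-- The block-value bound `B_q(τ)` (version without floating-component factor). -/
def Bq0 (τ : Shape) (n q : ℕ) (p cnorm : ℝ) : ℝ :=
  sSup { x : ℝ | ∃ S : Finset (Fin τ.m), IsSeparator τ S ∧
    x = (Real.sqrt n * q) ^ (Finset.univ \ S).card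
        * Real.sqrt ((1 - p) / p) ^ (edgesIn τ S).card
        * Real.sqrt n ^ (isolatedVerts τ).card
        * cnorm ^ τ.edges.card }

/-- The spectral norm (ℓ₂→ℓ₂ operator norm) of a rectangular real matrix. -/
def specNorm {α β : Type*} [Fintype α] [Fintype β] [DecidableEq α] [DecidableEq β]
    (M : Matrix α β ℝ) : ℝ :=
  ‖LinearMap.toContinuousLinearMap (Matrix.toEuclideanLin M)‖

end GM

namespace GM

/-- The set of endpoints of the edges in `R`. -/
def vertsOf {n : ℕ} (R : Finset (Sym2 (Fin n))) : Finset (Fin n) :=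
  Finset.univ.filter (fun v => ∃ e ∈ R, v ∈ e)

/-- Every connected component of the graph `(V(R), R)` contains a vertex of `S`. -/
def ConnectedToS {n : ℕ} (R : Finset (Sym2 (Fin n))) (S : Finset (Fin n)) : Prop :=
  ∀ v ∈ vertsOf R, ∃ s ∈ S,
    (SimpleGraph.fromEdgeSet (R : Set (Sym2 (Fin n)))).Reachable v s

/-- The pseudo-calibrated value `Λ_S(G)` with connected truncation at parameter `DV`. -/
def Lam (n : ℕ) (p k : ℝ) (DV : ℕ) (G : Graph n) (S : Finset (Fin n)) : ℝ :=
  ∑ R ∈ Finset.univ.filter (fun R : Finset (Sym2 (Fin n)) =>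
      (∀ e ∈ R, ¬ e.IsDiag) ∧ ConnectedToS R S ∧ (vertsOf R ∪ S).card ≤ DV),
    (k / n) ^ (vertsOf R ∪ S).card * (- Real.sqrt (p / (1 - p))) ^ R.card *
      ∏ e ∈ R, char p G e

end GM

namespace GMP
open GM

/-- Signed edge weight: `-1` on edges, `q` on non-edges. -/
def fe {n : ℕ} (q : ℝ) (G : Graph n) (e : Sym2 (Fin n)) : ℝ := if e ∈ G then -1 else q

def fH {n : ℕ} (q : ℝ) (G : Graph n) (H : Finset (Sym2 (Fin n))) : ℝ := ∏ e ∈ H, fe q G e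

def mu (n d : ℕ) (q : ℝ) (H : Finset (Sym2 (Fin n))) : ℝ :=
  ∑ G ∈ regularGraphs n d, fH q G H

def ind {n : ℕ} (G : Graph n) (e : Sym2 (Fin n)) : ℝ := if e ∈ G then 1 else 0

lemma mem_reg {n d : ℕ} {G : Graph n} :
    G ∈ regularGraphs n d ↔ IsSimpleG G ∧ ∀ v, degree G v = d := by
  simp [regularGraphs]

/-- the switched graph -/
def sw {n : ℕ} (a b x y : Fin n) (G : Graph n) : Graph n :=
  symmDiff G {s(a,b), s(x,y), s(a,x), s(b,y)}

lemma sw_sw {n : ℕ} (a b x y : Fin n) (G : Graph n) : sw a b x y (sw a b x y G) = G := by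
  simp [sw]

lemma degree_cast {n : ℕ} (G : Graph n) (v : Fin n) :
    (degree G v : ℤ) = ∑ e : Sym2 (Fin n), (if e ∈ G then (1:ℤ) else 0) * (if v ∈ e then 1 else 0) := by
  unfold degree
  rw [Finset.card_eq_sum_ones, Finset.sum_filter]
  push_cast
  rw [← Finset.sum_filter_add_sum_filter_not Finset.univ (fun e => e ∈ G)]
  have : (∑ e ∈ Finset.univ.filter (fun e => ¬ e ∈ G),
    (if e ∈ G then (1:ℤ) else 0) * (if v ∈ e then 1 else 0)) = 0 := by
    apply Finset.sum_eq_zero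
    intro e he
    simp at he
    simp [he]
  rw [this, add_zero]
  have h2 : Finset.univ.filter (fun e => e ∈ G) = G := by ext; simp
  rw [h2]
  apply Finset.sum_congr rfl
  intro e he
  simp [he]

lemma mem_sw {n : ℕ} (a b x y : Fin n) (G : Graph n) (e : Sym2 (Fin n)) :
    e ∈ sw a b x y G ↔ (e ∈ G ∧ ¬ (e = s(a,b) ∨ e = s(x,y) ∨ e = s(a,x) ∨ e = s(b,y))) ∨
      ((e = s(a,b) ∨ e = s(x,y) ∨ e = s(a,x) ∨ e = s(b,y)) ∧ e ∉ G) := by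
  simp [sw, Finset.mem_symmDiff]

lemma degree_sw {n : ℕ} {a b x y : Fin n} (hab : a ≠ b) (hax : a ≠ x) (hay : a ≠ y)
    (hbx : b ≠ x) (hby : b ≠ y) (hxy : x ≠ y) (G : Graph n)
    (h1 : s(a,b) ∈ G) (h2 : s(x,y) ∈ G) (h3 : s(a,x) ∉ G) (h4 : s(b,y) ∉ G) (v : Fin n) :
    degree (sw a b x y G) v = degree G v := by
  have key : (degree (sw a b x y G) v : ℤ) - degree G v = 0 := by
    rw [degree_cast, degree_cast, ← Finset.sum_sub_distrib]
    rw [← Finset.sum_subset (Finset.subset_univ ({s(a,b), s(x,y), s(a,x), s(b,y)} : Finset (Sym2 (Fin n))))]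
    · have n1 : s(a,b) ≠ s(x,y) := by simp; grind
      have n2 : s(a,b) ≠ s(a,x) := by simp; grind
      have n3 : s(a,b) ≠ s(b,y) := by simp; grind
      have n4 : s(x,y) ≠ s(a,x) := by simp; grind
      have n5 : s(x,y) ≠ s(b,y) := by simp; grind
      have n6 : s(a,x) ≠ s(b,y) := by simp; grind
      have d1 : ∀ p r : Fin n, p ≠ r → (if v ∈ s(p,r) then (1:ℤ) else 0) =
        (if v = p then 1 else 0) + (if v = r then 1 else 0) := by
        intro p r hpr
        simp only [Sym2.mem_iff]
        by_cases hp : v = p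
        · subst hp; simp [hpr]
        · simp [hp]
      rw [Finset.sum_insert (by simp [n1, n2, n3]), Finset.sum_insert (by simp [n4, n5]),
        Finset.sum_insert (by simp [n6]), Finset.sum_singleton]
      simp only [mem_sw, h1, h2, h3, h4, d1 _ _ hab, d1 _ _ hax, d1 _ _ hby, d1 _ _ hxy]
      simp
      ring
    · intro e _ he
      simp at he
      have : (e ∈ sw a b x y G) ↔ e ∈ G := by rw [mem_sw]; tauto
      simp [this]
  omega

lemma sw_reg {n d : ℕ} {a b x y : Fin n} (hab : a ≠ b) (hax : a ≠ x) (hay : a ≠ y)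
    (hbx : b ≠ x) (hby : b ≠ y) (hxy : x ≠ y) (G : Graph n) (hG : G ∈ regularGraphs n d)
    (h1 : s(a,b) ∈ G) (h2 : s(x,y) ∈ G) (h3 : s(a,x) ∉ G) (h4 : s(b,y) ∉ G) :
    sw a b x y G ∈ regularGraphs n d := by
  rw [mem_reg] at hG ⊢
  refine ⟨?_, fun v => by rw [degree_sw hab hax hay hbx hby hxy G h1 h2 h3 h4]; exact hG.2 v⟩
  intro e he
  rw [mem_sw] at he
  rcases he with h | ⟨h, _⟩
  · exact hG.1 e h.1
  · rcases h with rfl | rfl | rfl | rfl <;> simpa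

lemma sw_swap {n : ℕ} (a b x y : Fin n) (G : Graph n) : sw a x b y G = sw a b x y G := by
  ext e
  rw [mem_sw, mem_sw]
  tauto

/-- Switching identity. -/
lemma switching {n d : ℕ} {a b x y : Fin n} (hab : a ≠ b) (hax : a ≠ x) (hay : a ≠ y)
    (hbx : b ≠ x) (hby : b ≠ y) (hxy : x ≠ y) (g : Graph n → ℝ)
    (hg : ∀ G, g (sw a b x y G) = g G) :
    ∑ G ∈ regularGraphs n d, ind G s(a,b) * ind G s(x,y) * (1 - ind G s(a,x)) * (1 - ind G s(b,y)) * g G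
    = ∑ G ∈ regularGraphs n d, ind G s(a,x) * ind G s(b,y) * (1 - ind G s(a,b)) * (1 - ind G s(x,y)) * g G := by
  have L : ∀ G : Graph n, ind G s(a,b) * ind G s(x,y) * (1 - ind G s(a,x)) * (1 - ind G s(b,y)) * g G
    = if (s(a,b) ∈ G ∧ s(x,y) ∈ G ∧ s(a,x) ∉ G ∧ s(b,y) ∉ G) then g G else 0 := by
    intro G; unfold ind
    by_cases h1 : s(a,b) ∈ G <;> by_cases h2 : s(x,y) ∈ G <;> by_cases h3 : s(a,x) ∈ G <;>
      by_cases h4 : s(b,y) ∈ G <;> simp [h1, h2, h3, h4]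
  have R : ∀ G : Graph n, ind G s(a,x) * ind G s(b,y) * (1 - ind G s(a,b)) * (1 - ind G s(x,y)) * g G
    = if (s(a,x) ∈ G ∧ s(b,y) ∈ G ∧ s(a,b) ∉ G ∧ s(x,y) ∉ G) then g G else 0 := by
    intro G; unfold ind
    by_cases h1 : s(a,b) ∈ G <;> by_cases h2 : s(x,y) ∈ G <;> by_cases h3 : s(a,x) ∈ G <;>
      by_cases h4 : s(b,y) ∈ G <;> simp [h1, h2, h3, h4]
  simp_rw [L, R]
  rw [← Finset.sum_filter, ← Finset.sum_filter]
  apply Finset.sum_nbij' (sw a b x y) (sw a b x y)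
  · intro G hG
    simp only [Finset.mem_filter] at hG ⊢
    obtain ⟨hG, h1, h2, h3, h4⟩ := hG
    refine ⟨sw_reg hab hax hay hbx hby hxy G hG h1 h2 h3 h4, ?_⟩
    simp only [mem_sw]
    simp [h1, h2, h3, h4]
  · intro G hG
    simp only [Finset.mem_filter] at hG ⊢
    obtain ⟨hG, h1, h2, h3, h4⟩ := hG
    refine ⟨?_, ?_⟩
    · rw [← sw_swap]
      exact sw_reg hax hab hay hbx.symm hxy hby G hG h1 h2 h3 h4
    simp only [mem_sw]
    simp [h1, h2, h3, h4]
  · intro G _; exact sw_sw _ _ _ _ _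
  · intro G _; exact sw_sw _ _ _ _ _
  · intro G _; rw [hg]

lemma card_nbr {n : ℕ} (G : Graph n) (u : Fin n) :
    (Finset.univ.filter (fun v => s(u,v) ∈ G)).card = degree G u := by
  unfold degree
  apply Finset.card_bij (fun v _ => s(u,v))
  · intro v hv; simp at hv ⊢; exact hv
  · intro v _ w _ h; simp at h; grind
  · intro e he
    simp only [Finset.mem_filter] at he
    obtain ⟨w, rfl⟩ := he.2
    exact ⟨w, by simpa using he.1, rfl⟩

lemma sum_ind {n d : ℕ} {G : Graph n} (hG : G ∈ regularGraphs n d) (u : Fin n) :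
    ∑ v, ind G s(u,v) = d := by
  unfold ind
  rw [← Finset.sum_filter, Finset.sum_const, card_nbr, (mem_reg.1 hG).2 u]
  simp

lemma fe_ind {n : ℕ} (q : ℝ) (G : Graph n) (e) : fe q G e = q - (1 + q) * ind G e := by
  unfold fe ind; split_ifs <;> ring

lemma row_sum {n d : ℕ} {q : ℝ} (hq : q * ((n:ℝ) - d) = d) {G : Graph n}
    (hG : G ∈ regularGraphs n d) (u : Fin n) : ∑ v, fe q G s(u,v) = 0 := by
  simp_rw [fe_ind]
  rw [Finset.sum_sub_distrib, ← Finset.mul_sum, sum_ind hG]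
  simp
  linarith

lemma fe_diag {n d : ℕ} {q : ℝ} {G : Graph n}
    (hG : G ∈ regularGraphs n d) (u : Fin n) : fe q G s(u,u) = q := by
  unfold fe
  rw [if_neg]
  intro h
  exact (mem_reg.1 hG).1 _ h (by simp)

lemma fe_sq {n : ℕ} (q : ℝ) (G : Graph n) (e) : fe q G e * fe q G e = q - (1 - q) * fe q G e := by
  unfold fe; split_ifs <;> ring

end GMP

namespace GMP
open GM

def SimpleE {n : ℕ} (H : Finset (Sym2 (Fin n))) : Prop := ∀ e ∈ H, ¬ e.IsDiag

def ex (n d : ℕ) (φ : Graph n → ℝ) : ℝ := ∑ G ∈ regularGraphs n d, φ G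

lemma ex_congr {n d : ℕ} {φ ψ : Graph n → ℝ} (h : ∀ G ∈ regularGraphs n d, φ G = ψ G) :
    ex n d φ = ex n d ψ := Finset.sum_congr rfl h

lemma fH_sw {n : ℕ} (q : ℝ) {a b x y : Fin n} (G : Graph n) (H : Finset (Sym2 (Fin n)))
    (h1 : s(a,b) ∉ H) (h2 : s(x,y) ∉ H) (h3 : s(a,x) ∉ H) (h4 : s(b,y) ∉ H) :
    fH q (sw a b x y G) H = fH q G H := by
  unfold fH
  apply Finset.prod_congr rfl
  intro e he
  have : (e ∈ sw a b x y G) ↔ e ∈ G := by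
    rw [mem_sw]
    have : e ≠ s(a,b) := by rintro rfl; exact h1 he
    have : e ≠ s(x,y) := by rintro rfl; exact h2 he
    have : e ≠ s(a,x) := by rintro rfl; exact h3 he
    have : e ≠ s(b,y) := by rintro rfl; exact h4 he
    tauto
  simp [fe, this]

/-- the bracket in the loop equation -/
def br (q fab fxy fax fby : ℝ) : ℝ :=
  q * (fax + fby - fab - fxy) + (1 - q) * (fab * fxy - fax * fby) +
    (fab * fxy * fax + fab * fxy * fby - fax * fby * fab - fax * fby * fxy)

lemma loop_one {n d : ℕ} (q : ℝ) {a b x y : Fin n} (hab : a ≠ b) (hax : a ≠ x) (hay : a ≠ y)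
    (hbx : b ≠ x) (hby : b ≠ y) (hxy : x ≠ y) (H : Finset (Sym2 (Fin n)))
    (h1 : s(a,b) ∉ H) (h2 : s(x,y) ∉ H) (h3 : s(a,x) ∉ H) (h4 : s(b,y) ∉ H) :
    ex n d (fun G => br q (fe q G s(a,b)) (fe q G s(x,y)) (fe q G s(a,x)) (fe q G s(b,y)) * fH q G H) = 0 := by
  have := switching (d := d) hab hax hay hbx hby hxy (fun G => fH q G H)
    (fun G => fH_sw q G H h1 h2 h3 h4)
  have h2 : ex n d (fun G => br q (fe q G s(a,b)) (fe q G s(x,y)) (fe q G s(a,x)) (fe q G s(b,y)) * fH q G H)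
     = (1 + q)^3 * ((∑ G ∈ regularGraphs n d, ind G s(a,b) * ind G s(x,y) * (1 - ind G s(a,x)) * (1 - ind G s(b,y)) * fH q G H)
    - ∑ G ∈ regularGraphs n d, ind G s(a,x) * ind G s(b,y) * (1 - ind G s(a,b)) * (1 - ind G s(x,y)) * fH q G H) := by
    rw [← Finset.sum_sub_distrib, Finset.mul_sum]
    unfold ex
    apply Finset.sum_congr rfl
    intro G _
    simp only [fe_ind, br]
    ring
  rw [h2, this]; ring

/-- deterministic summation of the bracket -/
lemma br_sum {n : ℕ} (q : ℝ) (F : Fin n → Fin n → ℝ)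
    (hrow : ∀ u, ∑ v, F u v = 0) (hsymm : ∀ u v, F u v = F v u) (hdiag : ∀ u, F u u = q)
    (W : Finset (Fin n)) (a b : Fin n) :
    ∑ x ∈ Wᶜ, ∑ y ∈ Wᶜ.erase x, br q (F a b) (F x y) (F a x) (F b y) =
    - q * ((Wᶜ).card - 1) * (∑ u ∈ W, F a u + ∑ u ∈ W, F b u)
    - q * (Wᶜ).card * ((Wᶜ).card - 1) * F a b
    - q * (∑ u ∈ W, ∑ u' ∈ W, F u u' - q * (Wᶜ).card)
    + (1 - q) * (F a b * (∑ u ∈ W, ∑ u' ∈ W, F u u' - q * (Wᶜ).card))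
    - (1 - q) * ((∑ u ∈ W, F a u) * (∑ u ∈ W, F b u) - ∑ x ∈ Wᶜ, F a x * F b x)
    + ∑ x ∈ Wᶜ, ∑ y ∈ Wᶜ.erase x, (F a b * F x y * F a x + F a b * F x y * F b y
        - F a x * F b y * F a b - F a x * F b y * F x y) := by
  have hU : ∀ u, ∑ x ∈ Wᶜ, F u x = - ∑ v ∈ W, F u v := by
    intro u
    have := Finset.sum_add_sum_compl W (fun v => F u v)
    rw [hrow] at this
    linarith
  have hS : ∑ x ∈ Wᶜ, ∑ y ∈ Wᶜ, F x y = ∑ u ∈ W, ∑ u' ∈ W, F u u' := by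
    simp_rw [hU]
    rw [Finset.sum_neg_distrib, Finset.sum_comm]
    simp_rw [fun (x y : Fin n) => hsymm x y]
    rw [← Finset.sum_neg_distrib]
    apply Finset.sum_congr rfl
    intro u _
    rw [hU]; ring_nf
  have her : ∀ φ : Fin n → Fin n → ℝ, ∑ x ∈ Wᶜ, ∑ y ∈ Wᶜ.erase x, φ x y
      = ∑ x ∈ Wᶜ, ∑ y ∈ Wᶜ, φ x y - ∑ x ∈ Wᶜ, φ x x := by
    intro φ
    rw [← Finset.sum_sub_distrib]
    apply Finset.sum_congr rfl
    intro x hx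
    rw [← Finset.add_sum_erase _ _ hx]; ring
  have hsplit : ∑ x ∈ Wᶜ, ∑ y ∈ Wᶜ.erase x, br q (F a b) (F x y) (F a x) (F b y) =
    q * (∑ x ∈ Wᶜ, ∑ y ∈ Wᶜ.erase x, F a x + ∑ x ∈ Wᶜ, ∑ y ∈ Wᶜ.erase x, F b y
      - ∑ x ∈ Wᶜ, ∑ y ∈ Wᶜ.erase x, F a b - ∑ x ∈ Wᶜ, ∑ y ∈ Wᶜ.erase x, F x y)
    + (1 - q) * (F a b * (∑ x ∈ Wᶜ, ∑ y ∈ Wᶜ.erase x, F x y) - ∑ x ∈ Wᶜ, ∑ y ∈ Wᶜ.erase x, F a x * F b y)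
    + ∑ x ∈ Wᶜ, ∑ y ∈ Wᶜ.erase x, (F a b * F x y * F a x + F a b * F x y * F b y
        - F a x * F b y * F a b - F a x * F b y * F x y) := by
    simp only [br, Finset.sum_add_distrib, Finset.sum_sub_distrib, ← Finset.mul_sum]
  rw [hsplit]
  have t1 : ∑ x ∈ Wᶜ, ∑ y ∈ Wᶜ.erase x, F a x = ((Wᶜ).card - 1) * (- ∑ u ∈ W, F a u) := by
    rw [her]
    simp only [Finset.sum_const, nsmul_eq_mul, ← Finset.mul_sum]
    rw [hU]; ring
  have t2 : ∑ x ∈ Wᶜ, ∑ y ∈ Wᶜ.erase x, F b y = ((Wᶜ).card - 1) * (- ∑ u ∈ W, F b u) := by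
    rw [her]
    simp only [Finset.sum_const, nsmul_eq_mul]
    rw [hU]; ring
  have t3 : ∑ x ∈ Wᶜ, ∑ y ∈ Wᶜ.erase x, F a b = (Wᶜ).card * ((Wᶜ).card - 1) * F a b := by
    rw [her]
    simp only [Finset.sum_const, nsmul_eq_mul]
    ring
  have t4 : ∑ x ∈ Wᶜ, ∑ y ∈ Wᶜ.erase x, F x y = ∑ u ∈ W, ∑ u' ∈ W, F u u' - q * (Wᶜ).card := by
    rw [her, hS]
    simp only [hdiag, Finset.sum_const, nsmul_eq_mul]
    ring
  have t5 : ∑ x ∈ Wᶜ, ∑ y ∈ Wᶜ.erase x, F a x * F b y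
     = (∑ u ∈ W, F a u) * (∑ u ∈ W, F b u) - ∑ x ∈ Wᶜ, F a x * F b x := by
    rw [her]
    simp only [← Finset.mul_sum, ← Finset.sum_mul]
    rw [hU, hU]; ring
  rw [t1, t2, t3, t4, t5]
  ring

lemma notin_of_verts {n : ℕ} {H : Finset (Sym2 (Fin n))} {x y : Fin n} (h : x ∉ vertsOf H) :
    s(x,y) ∉ H := by
  intro h'
  apply h
  simp [vertsOf]
  exact ⟨_, h', by simp⟩

lemma notin_of_verts' {n : ℕ} {H : Finset (Sym2 (Fin n))} {x y : Fin n} (h : y ∉ vertsOf H) :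
    s(x,y) ∉ H := by
  rw [Sym2.eq_swap]; exact notin_of_verts h

lemma mem_verts {n : ℕ} {H : Finset (Sym2 (Fin n))} {x y : Fin n} (h : s(x,y) ∈ H) :
    x ∈ vertsOf H ∧ y ∈ vertsOf H := by
  simp only [vertsOf, Finset.mem_filter, Finset.mem_univ, true_and]
  exact ⟨⟨_, h, by simp⟩, ⟨_, h, by simp⟩⟩

lemma fH_erase {n : ℕ} (q : ℝ) (G : Graph n) {H : Finset (Sym2 (Fin n))} {e} (h : e ∈ H) :
    fe q G e * fH q G (H.erase e) = fH q G H := by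
  unfold fH; exact Finset.mul_prod_erase _ _ h

lemma fH_insert {n : ℕ} (q : ℝ) (G : Graph n) {H : Finset (Sym2 (Fin n))} {e} (h : e ∉ H) :
    fH q G (insert e H) = fe q G e * fH q G H := by
  unfold fH; exact Finset.prod_insert h

lemma ex_add {n d : ℕ} (φ ψ : Graph n → ℝ) : ex n d (fun G => φ G + ψ G) = ex n d φ + ex n d ψ :=
  Finset.sum_add_distrib
lemma ex_sub {n d : ℕ} (φ ψ : Graph n → ℝ) : ex n d (fun G => φ G - ψ G) = ex n d φ - ex n d ψ :=
  Finset.sum_sub_distrib _ _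
lemma ex_mul {n d : ℕ} (c : ℝ) (φ : Graph n → ℝ) : ex n d (fun G => c * φ G) = c * ex n d φ :=
  (Finset.mul_sum _ _ _).symm
lemma ex_sum {n d : ℕ} {ι : Type*} (s : Finset ι) (φ : ι → Graph n → ℝ) :
    ex n d (fun G => ∑ i ∈ s, φ i G) = ∑ i ∈ s, ex n d (φ i) :=
  Finset.sum_comm

lemma loop_eq {n d : ℕ} {q : ℝ} (hq : q * ((n:ℝ) - d) = d) {H : Finset (Sym2 (Fin n))}
    (hH : SimpleE H) {a b : Fin n} (hab : s(a,b) ∈ H) (W : Finset (Fin n)) (hW : W = vertsOf H)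
    (N : ℝ) (hN : N = (Wᶜ).card) (g : Graph n → ℝ) (hg : g = fun G => fH q G (H.erase s(a,b))) :
    q * N * (N - 1) * mu n d q H =
    - q * (N - 1) * (∑ u ∈ W, ex n d (fun G => fe q G s(a,u) * g G)
        + ∑ u ∈ W, ex n d (fun G => fe q G s(b,u) * g G))
    - q * (∑ u ∈ W, ∑ u' ∈ W, ex n d (fun G => fe q G s(u,u') * g G) - q * N * ex n d g)
    + (1 - q) * (∑ u ∈ W, ∑ u' ∈ W, ex n d (fun G => fe q G s(u,u') * fH q G H) - q * N * mu n d q H)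
    - (1 - q) * (∑ u ∈ W, ∑ u' ∈ W, ex n d (fun G => fe q G s(a,u) * (fe q G s(b,u') * g G))
        - ∑ x ∈ Wᶜ, ex n d (fun G => fe q G s(a,x) * (fe q G s(b,x) * g G)))
    + ∑ x ∈ Wᶜ, ∑ y ∈ Wᶜ.erase x, (ex n d (fun G => fe q G s(x,y) * (fe q G s(a,x) * fH q G H))
        + ex n d (fun G => fe q G s(x,y) * (fe q G s(b,y) * fH q G H))
        - ex n d (fun G => fe q G s(a,x) * (fe q G s(b,y) * fH q G H))
        - ex n d (fun G => fe q G s(x,y) * (fe q G s(a,x) * (fe q G s(b,y) * g G)))) := by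
  have habne : a ≠ b := by
    have := hH _ hab; simpa using this
  have hzero : ∑ x ∈ Wᶜ, ∑ y ∈ Wᶜ.erase x, ex n d (fun G => br q (fe q G s(a,b)) (fe q G s(x,y)) (fe q G s(a,x)) (fe q G s(b,y)) * g G) = 0 := by
    apply Finset.sum_eq_zero
    intro x hx
    apply Finset.sum_eq_zero
    intro y hy
    have haW := (mem_verts hab).1
    have hbW := (mem_verts hab).2
    simp only [Finset.mem_erase, Finset.mem_compl, hW] at hx hy
    have hx' : ∀ z, s(x,z) ∉ H.erase s(a,b) := fun z h => notin_of_verts hx (Finset.mem_of_mem_erase h)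
    have hx_pp : ∀ z, s(z,x) ∉ H.erase s(a,b) := fun z h => notin_of_verts' hx (Finset.mem_of_mem_erase h)
    have hy_pp : ∀ z, s(z,y) ∉ H.erase s(a,b) := fun z h => notin_of_verts' hy.2 (Finset.mem_of_mem_erase h)
    rw [hg]
    exact loop_one q habne (by rintro rfl; exact hx haW) (by rintro rfl; exact hy.2 haW)
      (by rintro rfl; exact hx hbW) (by rintro rfl; exact hy.2 hbW) (Ne.symm hy.1) _
      (by simp) (hx' _) (hx_pp _) (hy_pp _)
  have hpt : ∀ G ∈ regularGraphs n d, ∑ x ∈ Wᶜ, ∑ y ∈ Wᶜ.erase x, br q (fe q G s(a,b)) (fe q G s(x,y)) (fe q G s(a,x)) (fe q G s(b,y)) * g G =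
    - (q * (N - 1)) * (∑ u ∈ W, fe q G s(a,u) * g G + ∑ u ∈ W, fe q G s(b,u) * g G)
    - (q * N * (N - 1)) * fH q G H
    - q * (∑ u ∈ W, ∑ u' ∈ W, fe q G s(u,u') * g G - (q * N) * g G)
    + (1 - q) * (∑ u ∈ W, ∑ u' ∈ W, fe q G s(u,u') * fH q G H - (q * N) * fH q G H)
    - (1 - q) * (∑ u ∈ W, ∑ u' ∈ W, fe q G s(a,u) * (fe q G s(b,u') * g G)
        - ∑ x ∈ Wᶜ, fe q G s(a,x) * (fe q G s(b,x) * g G))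
    + ∑ x ∈ Wᶜ, ∑ y ∈ Wᶜ.erase x, (fe q G s(x,y) * (fe q G s(a,x) * fH q G H)
        + fe q G s(x,y) * (fe q G s(b,y) * fH q G H)
        - fe q G s(a,x) * (fe q G s(b,y) * fH q G H)
        - fe q G s(x,y) * (fe q G s(a,x) * (fe q G s(b,y) * g G))) := by
    intro G hG
    have hfab : fH q G H = fe q G s(a,b) * g G := by rw [hg]; exact (fH_erase q G hab).symm
    have h0 := br_sum q (fun u v => fe q G s(u,v)) (fun u => row_sum hq hG u)
      (fun u v => by rw [Sym2.eq_swap]) (fun u => fe_diag hG u) W a b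
    simp only [← Finset.sum_mul]
    rw [h0, ← hN, hfab]
    have e1 : (∑ u ∈ W, fe q G s(a,u)) * (∑ u ∈ W, fe q G s(b,u)) * g G
      = ∑ u ∈ W, ∑ u' ∈ W, fe q G s(a,u) * (fe q G s(b,u') * g G) := by
      rw [Finset.sum_mul_sum, Finset.sum_mul]
      apply Finset.sum_congr rfl; intro u _
      rw [Finset.sum_mul]
      apply Finset.sum_congr rfl; intro u' _
      ring
    have e2 : (∑ x ∈ Wᶜ, fe q G s(a,x) * fe q G s(b,x)) * g G
      = ∑ x ∈ Wᶜ, fe q G s(a,x) * (fe q G s(b,x) * g G) := by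
      rw [Finset.sum_mul]
      apply Finset.sum_congr rfl; intro u _; ring
    have e3 : (∑ x ∈ Wᶜ, ∑ y ∈ Wᶜ.erase x, (fe q G s(a,b) * fe q G s(x,y) * fe q G s(a,x) + fe q G s(a,b) * fe q G s(x,y) * fe q G s(b,y)
        - fe q G s(a,x) * fe q G s(b,y) * fe q G s(a,b) - fe q G s(a,x) * fe q G s(b,y) * fe q G s(x,y))) * g G
      = ∑ x ∈ Wᶜ, ∑ y ∈ Wᶜ.erase x, (fe q G s(x,y) * (fe q G s(a,x) * (fe q G s(a,b) * g G))
        + fe q G s(x,y) * (fe q G s(b,y) * (fe q G s(a,b) * g G))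
        - fe q G s(a,x) * (fe q G s(b,y) * (fe q G s(a,b) * g G))
        - fe q G s(x,y) * (fe q G s(a,x) * (fe q G s(b,y) * g G))) := by
      rw [Finset.sum_mul]
      apply Finset.sum_congr rfl; intro u _
      rw [Finset.sum_mul]
      apply Finset.sum_congr rfl; intro u' _
      ring
    rw [← e1, ← e2, ← e3]
    ring
  have hfin : ex n d (fun G => ∑ x ∈ Wᶜ, ∑ y ∈ Wᶜ.erase x, br q (fe q G s(a,b)) (fe q G s(x,y)) (fe q G s(a,x)) (fe q G s(b,y)) * g G) = 0 := by
    rw [← hzero]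
    simp only [ex_sum]
  rw [ex_congr hpt] at hfin
  simp only [ex_add, ex_sub, ex_mul, ex_sum] at hfin
  have hmu : ex n d (fun G => fH q G H) = mu n d q H := rfl
  rw [hmu] at hfin
  have hgg : ex n d (fun G => g G) = ex n d g := rfl
  rw [hgg] at hfin
  linarith
end GMP

namespace GMP
open GM

lemma simple_insert {n : ℕ} {H : Finset (Sym2 (Fin n))} (hH : SimpleE H) {a b : Fin n} (h : a ≠ b) :
    SimpleE (insert s(a,b) H) := by
  intro e he
  rw [Finset.mem_insert] at he
  rcases he with rfl | he
  · simpa using h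
  · exact hH e he

lemma simple_erase {n : ℕ} {H : Finset (Sym2 (Fin n))} (hH : SimpleE H) (e) :
    SimpleE (H.erase e) := fun e' he => hH e' (Finset.mem_of_mem_erase he)

lemma card_nb_le {n : ℕ} (H : Finset (Sym2 (Fin n))) (a : Fin n) (W : Finset (Fin n)) :
    (W.filter (fun u => s(a,u) ∈ H)).card ≤ H.card := by
  apply Finset.card_le_card_of_injOn (fun u => s(a,u))
  · intro u hu; simp at hu; exact hu.2
  · intro u _ v _ h; simp at h; grind

/-- Row lemma for an abstract seminorm-like functional. -/
lemma row_lemma {n d : ℕ} {q b τ θ M : ℝ} (β : ℕ → ℝ) (hq0 : 0 ≤ q) (hq1 : q ≤ 1) (hb : 0 < b)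
    (hτ : 0 ≤ τ) (hM : 0 ≤ M)
    (hβ : ∀ e, 0 ≤ β e) (hβ1 : ∀ e, β (e+1) ≤ τ * β e) (hβ2 : ∀ e, b * β e ≤ β (e+1))
    (ν : (Graph n → ℝ) → ℝ)
    (hν : ∀ c₁ c₂ φ₁ φ₂, ν (fun G => c₁ * φ₁ G + c₂ * φ₂ G) ≤ |c₁| * ν φ₁ + |c₂| * ν φ₂)
    (hνc : ∀ φ ψ : Graph n → ℝ, (∀ G ∈ regularGraphs n d, φ G = ψ G) → ν φ = ν ψ)
    (L : ℕ) (hνH : ∀ H, SimpleE H → H.card ≤ L + 1 → ν (fun G => fH q G H) ≤ M * β H.card)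
    (W : Finset (Fin n)) (a : Fin n) (H : Finset (Sym2 (Fin n))) (hH : SimpleE H) (hL : H.card ≤ L)
    (hθ : W.card * τ + q + H.card * (1 + q / b) ≤ θ) :
    ∑ u ∈ W, ν (fun G => fe q G s(a,u) * fH q G H) ≤ θ * M * β H.card := by
  have hMb : 0 ≤ M * β H.card := mul_nonneg hM (hβ _)
  have per : ∀ u ∈ W, ν (fun G => fe q G s(a,u) * fH q G H) ≤
      (τ + (if u = a then q else 0) + (if s(a,u) ∈ H then (1 + q / b) else 0)) * (M * β H.card) := by
    intro u _
    have hqb : 0 ≤ q / b := by positivity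
    by_cases hu : u = a
    · subst hu
      have : ν (fun G => fe q G s(u,u) * fH q G H) ≤ q * (M * β H.card) := by
        have h1 : ν (fun G => fe q G s(u,u) * fH q G H) = ν (fun G => q * fH q G H + 0 * fH q G H) := by
          apply hνc; intro G hG; rw [fe_diag hG]; ring
        rw [h1]
        refine (hν _ _ _ _).trans ?_
        simp only [abs_zero, zero_mul, add_zero, abs_of_nonneg hq0]
        exact mul_le_mul_of_nonneg_left (hνH H hH (by omega)) hq0
      refine this.trans ?_
      apply mul_le_mul_of_nonneg_right _ hMb
      simp only [if_true]
      split_ifs <;> linarith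
    · by_cases hin : s(a,u) ∈ H
      · simp only [hu, hin, if_true, if_false]
        have h1 : (fun G => fe q G s(a,u) * fH q G H) =
            fun G => q * fH q G (H.erase s(a,u)) + (-(1-q)) * fH q G H := by
          funext G
          rw [← fH_erase q G hin, ← mul_assoc, fe_sq]; ring
        rw [h1]
        refine (hν _ _ _ _).trans ?_
        have hc : (H.erase s(a,u)).card + 1 = H.card := Finset.card_erase_add_one hin
        have i1 := hνH H hH (by omega)
        have i2 := hνH (H.erase s(a,u)) (simple_erase hH _) (by omega)
        have i3 := hβ2 (H.erase s(a,u)).card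
        rw [hc] at i3
        have i4 : β (H.erase s(a,u)).card ≤ β H.card / b := by
          rw [le_div_iff₀ hb]; linarith
        have i5 : |q| * ν (fun G => fH q G (H.erase s(a,u))) ≤ q / b * (M * β H.card) := by
          rw [abs_of_nonneg hq0]
          calc q * ν (fun G => fH q G (H.erase s(a,u))) ≤ q * (M * (β H.card / b)) := by
                apply mul_le_mul_of_nonneg_left _ hq0
                exact i2.trans (mul_le_mul_of_nonneg_left i4 hM)
            _ = _ := by ring
        have i6 : |(-(1-q))| * ν (fun G => fH q G H) ≤ 1 * (M * β H.card) := by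
          rw [abs_neg, abs_of_nonneg (by linarith)]
          calc (1-q) * ν (fun G => fH q G H) ≤ (1-q) * (M * β H.card) :=
                mul_le_mul_of_nonneg_left i1 (by linarith)
            _ ≤ _ := mul_le_mul_of_nonneg_right (by linarith) hMb
        nlinarith [mul_nonneg hτ hMb]
      · simp only [hu, hin, if_false, add_zero]
        have h1 : ν (fun G => fe q G s(a,u) * fH q G H) =
            ν (fun G => fH q G (insert s(a,u) H)) := by
          congr 1; funext G; rw [fH_insert q G hin]
        rw [h1]
        have hc := Finset.card_insert_of_notMem hin
        have := hνH (insert s(a,u) H) (simple_insert hH (Ne.symm hu)) (by omega)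
        rw [hc] at this
        refine this.trans ?_
        calc M * β (H.card + 1) ≤ M * (τ * β H.card) := mul_le_mul_of_nonneg_left (hβ1 _) hM
          _ = _ := by ring
  refine (Finset.sum_le_sum per).trans ?_
  rw [← Finset.sum_mul, mul_assoc]
  apply mul_le_mul_of_nonneg_right _ hMb
  refine le_trans ?_ hθ
  rw [Finset.sum_add_distrib, Finset.sum_add_distrib, Finset.sum_const, nsmul_eq_mul,
    ← Finset.sum_filter, ← Finset.sum_filter, Finset.sum_const, Finset.sum_const, nsmul_eq_mul, nsmul_eq_mul]
  have c1 : ((W.filter (fun u => u = a)).card : ℝ) ≤ 1 := by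
    have : (W.filter (fun u => u = a)).card ≤ ({a} : Finset (Fin n)).card := by
      apply Finset.card_le_card; intro u hu; simp at hu; simp [hu.2]
    simpa using (Nat.cast_le (α := ℝ)).2 this
  have c2 : ((W.filter (fun u => s(a,u) ∈ H)).card : ℝ) ≤ H.card := by
    exact_mod_cast card_nb_le H a W
  have hqb : 0 ≤ q / b := by positivity
  have := mul_le_mul_of_nonneg_right c2 (by linarith : 0 ≤ 1 + q / b)
  nlinarith

lemma abs_ex_lin {n d : ℕ} (c₁ c₂ : ℝ) (φ₁ φ₂ : Graph n → ℝ) :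
    |ex n d (fun G => c₁ * φ₁ G + c₂ * φ₂ G)| ≤ |c₁| * |ex n d φ₁| + |c₂| * |ex n d φ₂| := by
  rw [ex_add, ex_mul, ex_mul, ← abs_mul, ← abs_mul]
  exact abs_add_le _ _

lemma tri5 {A B C D E a b c d e : ℝ} (hA : |A| ≤ a) (hB : |B| ≤ b) (hC : |C| ≤ c) (hD : |D| ≤ d)
    (hE : |E| ≤ e) : |A - B + C - D + E| ≤ a + b + c + d + e := by
  rw [abs_le] at *
  constructor <;> linarith [hA.1, hA.2, hB.1, hB.2, hC.1, hC.2, hD.1, hD.2, hE.1, hE.2]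

lemma contr_arith {q N θ b X τ w Z1 Z2 Z3 Z4 Z5 Z6 Z7 Z8 Z9 : ℝ} (hq0 : 0 < q) (hq1 : q ≤ 1) (hb : 0 < b)
    (hN1 : 2 ≤ N) (hX0 : 0 ≤ X)
    (A1 : |Z1| ≤ θ * (X / b)) (A2 : |Z2| ≤ θ * (X / b)) (A3 : |Z3| ≤ w * (θ * (X / b)))
    (A4 : |Z4| ≤ X / b) (A5 : |Z5| ≤ w * (θ * X)) (A6 : |Z6| ≤ X) (A7 : |Z7| ≤ θ^2 * (X / b))
    (A8 : |Z8| ≤ N * (τ * X)) (A9 : |Z9| ≤ N * (N * (4 * (τ^2 * X)))) :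
    |- q * (N - 1) * (Z1 + Z2) - q * (Z3 - q * N * Z4) + (1 - q) * (Z5 - q * N * Z6)
      - (1 - q) * (Z7 - Z8) + Z9| ≤ (2 * q * (N - 1) * (θ / b) + q * (w * θ + q * N) / b
        + (w * θ + q * N) + (θ^2 / b + N * τ) + 4 * N^2 * τ^2) * X := by
  have hN0 : 0 ≤ N := by linarith
  have hN10 : 0 ≤ N - 1 := by linarith
  have B1 : |- q * (N - 1) * (Z1 + Z2)| ≤ q * (N-1) * (2 * (θ * (X / b))) := by
    rw [abs_mul]
    have : |-q * (N-1)| = q * (N-1) := by rw [neg_mul, abs_neg, abs_of_nonneg (by positivity)]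
    rw [this]
    apply mul_le_mul_of_nonneg_left _ (by positivity)
    exact (abs_add_le _ _).trans (by linarith)
  have B2 : |q * (Z3 - q * N * Z4)| ≤ q * (w * (θ * (X / b)) + q * N * (X / b)) := by
    rw [abs_mul, abs_of_pos hq0]
    apply mul_le_mul_of_nonneg_left _ hq0.le
    refine (abs_sub _ _).trans (add_le_add A3 ?_)
    rw [abs_mul, abs_of_nonneg (by positivity)]
    exact mul_le_mul_of_nonneg_left A4 (by positivity)
  have hq' : |1 - q| ≤ 1 := by rw [abs_le]; constructor <;> linarith
  have B3 : |(1 - q) * (Z5 - q * N * Z6)| ≤ w * (θ * X) + q * N * X := by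
    rw [abs_mul]
    refine (mul_le_mul_of_nonneg_right hq' (abs_nonneg _)).trans ?_
    rw [one_mul]
    refine (abs_sub _ _).trans (add_le_add A5 ?_)
    rw [abs_mul, abs_of_nonneg (by positivity)]
    exact mul_le_mul_of_nonneg_left A6 (by positivity)
  have B4 : |(1 - q) * (Z7 - Z8)| ≤ θ^2 * (X / b) + N * (τ * X) := by
    rw [abs_mul]
    refine (mul_le_mul_of_nonneg_right hq' (abs_nonneg _)).trans ?_
    rw [one_mul]
    exact (abs_sub _ _).trans (add_le_add A7 A8)
  refine (tri5 B1 B2 B3 B4 A9).trans (le_of_eq ?_)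
  field_simp

lemma contraction {n d : ℕ} {q b τ θ T : ℝ} (β : ℕ → ℝ) (hq : q * ((n:ℝ) - d) = d)
    (hq0 : 0 < q) (hq1 : q ≤ 1) (hb : 0 < b)
    (hτ : 0 ≤ τ) (hT : 0 ≤ T) (hθ0 : 0 ≤ θ)
    (hβ : ∀ e, 0 ≤ β e) (hβ1 : ∀ e, β (e+1) ≤ τ * β e) (hβ2 : ∀ e, b * β e ≤ β (e+1))
    (L : ℕ) (hyp : ∀ H : Finset (Sym2 (Fin n)), SimpleE H → H.card ≤ L + 2 → |mu n d q H| ≤ T * β H.card)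
    (H : Finset (Sym2 (Fin n))) (hH : SimpleE H) (hL : H.card ≤ L) (hne : H.Nonempty)
    (hθ : (vertsOf H).card * τ + q + (L + 2) * (1 + q / b) ≤ θ)
    (N : ℝ) (hN : N = ((vertsOf H)ᶜ).card) (hN1 : 2 ≤ N) :
    q * N * (N - 1) * |mu n d q H| ≤
      (2 * q * (N - 1) * (θ / b) + q * ((vertsOf H).card * θ + q * N) / b
        + ((vertsOf H).card * θ + q * N) + (θ^2 / b + N * τ) + 4 * N^2 * τ^2) * (T * β H.card) := by
  obtain ⟨e, he⟩ := hne
  induction e using Sym2.ind with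
  | h a b' =>
  set W := vertsOf H with hW
  set g : Graph n → ℝ := fun G => fH q G (H.erase s(a,b')) with hg
  have hL1 := loop_eq hq hH he W hW N hN g hg
  have hqb : 0 ≤ q / b := by positivity
  have hTb : ∀ e, 0 ≤ T * β e := fun e => mul_nonneg hT (hβ e)
  have hc : (H.erase s(a,b')).card + 1 = H.card := Finset.card_erase_add_one he
  have hHe := simple_erase hH s(a,b')
  have hβe : T * β (H.erase s(a,b')).card ≤ T * β H.card / b := by
    have := hβ2 (H.erase s(a,b')).card
    rw [hc] at this
    rw [le_div_iff₀ hb]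
    calc _ = T * (b * β (H.erase s(a,b')).card) := by ring
      _ ≤ _ := mul_le_mul_of_nonneg_left this hT
  have row : ∀ (K : Finset (Sym2 (Fin n))), SimpleE K → K.card ≤ L + 1 → ∀ z : Fin n,
      ∑ u ∈ W, |ex n d (fun G => fe q G s(z,u) * fH q G K)| ≤ θ * T * β K.card := by
    intro K hK hKL z
    refine row_lemma β hq0.le hq1 hb hτ hT hβ hβ1 hβ2 (fun φ => |ex n d φ|) abs_ex_lin
      (fun φ ψ h => by show |ex n d φ| = |ex n d ψ|; rw [ex_congr h]) (L+1) (fun K hK h => hyp K hK (by omega)) W z K hK hKL ?_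
    refine le_trans ?_ hθ
    have : (K.card : ℝ) ≤ L + 2 := by
      have : K.card ≤ L + 2 := by omega
      exact_mod_cast this
    nlinarith
  have row2 : ∑ u ∈ W, ∑ u' ∈ W, |ex n d (fun G => fe q G s(a,u) * (fe q G s(b',u') * g G))|
      ≤ θ * (θ * T) * β (H.erase s(a,b')).card := by
    rw [Finset.sum_comm]
    refine row_lemma (d := d) β hq0.le hq1 hb hτ (mul_nonneg hθ0 hT) hβ hβ1 hβ2
      (fun φ => ∑ u ∈ W, |ex n d (fun G => fe q G s(a,u) * φ G)|) ?_ ?_ L ?_ W b' _ hHe (by omega) ?_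
    · intro c₁ c₂ φ₁ φ₂
      rw [Finset.mul_sum, Finset.mul_sum, ← Finset.sum_add_distrib]
      apply Finset.sum_le_sum
      intro u _
      refine le_trans (le_of_eq ?_) (abs_ex_lin c₁ c₂ _ _)
      congr 1
      apply ex_congr
      intro G _; ring
    · intro φ ψ h
      apply Finset.sum_congr rfl
      intro u _
      congr 1
      apply ex_congr
      intro G hG; rw [h G hG]
    · intro K hK hKL
      exact row K hK (by omega) a
    · refine le_trans ?_ hθ
      have : ((H.erase s(a,b')).card : ℝ) ≤ L + 2 := by
        have : (H.erase s(a,b')).card ≤ L + 2 := by omega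
        exact_mod_cast this
      nlinarith
  have A1 : |∑ u ∈ W, ex n d (fun G => fe q G s(a,u) * g G)| ≤ θ * (T * β H.card / b) := by
    refine (Finset.abs_sum_le_sum_abs _ _).trans ((row _ hHe (by omega) a).trans ?_)
    rw [mul_assoc]; exact mul_le_mul_of_nonneg_left hβe hθ0
  have A2 : |∑ u ∈ W, ex n d (fun G => fe q G s(b',u) * g G)| ≤ θ * (T * β H.card / b) := by
    refine (Finset.abs_sum_le_sum_abs _ _).trans ((row _ hHe (by omega) b').trans ?_)
    rw [mul_assoc]; exact mul_le_mul_of_nonneg_left hβe hθ0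
  have A3 : |∑ u ∈ W, ∑ u' ∈ W, ex n d (fun G => fe q G s(u,u') * g G)| ≤ W.card * (θ * (T * β H.card / b)) := by
    refine (Finset.abs_sum_le_sum_abs _ _).trans ?_
    rw [← nsmul_eq_mul]
    apply Finset.sum_le_card_nsmul
    intro u _
    refine (Finset.abs_sum_le_sum_abs _ _).trans ((row _ hHe (by omega) u).trans ?_)
    rw [mul_assoc]; exact mul_le_mul_of_nonneg_left hβe hθ0
  have A4 : |ex n d g| ≤ T * β H.card / b := (hyp _ hHe (by omega)).trans hβe
  have A5 : |∑ u ∈ W, ∑ u' ∈ W, ex n d (fun G => fe q G s(u,u') * fH q G H)| ≤ W.card * (θ * (T * β H.card)) := by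
    refine (Finset.abs_sum_le_sum_abs _ _).trans ?_
    rw [← nsmul_eq_mul]
    apply Finset.sum_le_card_nsmul
    intro u _
    refine (Finset.abs_sum_le_sum_abs _ _).trans ((row _ hH (by omega) u).trans ?_)
    rw [mul_assoc]
  have A6 : |mu n d q H| ≤ T * β H.card := hyp _ hH (by omega)
  have A7 : |∑ u ∈ W, ∑ u' ∈ W, ex n d (fun G => fe q G s(a,u) * (fe q G s(b',u') * g G))| ≤ θ^2 * (T * β H.card / b) := by
    refine (Finset.abs_sum_le_sum_abs _ _).trans ?_
    refine (Finset.sum_le_sum (fun u _ => Finset.abs_sum_le_sum_abs _ _)).trans (row2.trans ?_)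
    have := mul_le_mul_of_nonneg_left hβe (by positivity : 0 ≤ θ^2)
    linarith
  have haW : a ∈ W := (mem_verts he).1
  have hbW : b' ∈ W := (mem_verts he).2
  have habne : a ≠ b' := by simpa using hH _ he
  have hWn : ∀ x ∈ Wᶜ, x ≠ a ∧ x ≠ b' ∧ (∀ z, s(x,z) ∉ H) ∧ (∀ z, s(z,x) ∉ H) := by
    intro x hx
    rw [Finset.mem_compl] at hx
    exact ⟨by rintro rfl; exact hx haW, by rintro rfl; exact hx hbW,
      fun z => notin_of_verts hx, fun z => notin_of_verts' hx⟩
  have two : ∀ (K : Finset (Sym2 (Fin n))) (x1 y1 x2 y2 : Fin n), SimpleE K → K.card ≤ L →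
      x1 ≠ y1 → x2 ≠ y2 → s(x2,y2) ∉ K → s(x1,y1) ∉ K → s(x1,y1) ≠ s(x2,y2) →
      |ex n d (fun G => fe q G s(x1,y1) * (fe q G s(x2,y2) * fH q G K))| ≤ T * β (K.card + 2) := by
    intro K x1 y1 x2 y2 hK hKL h1 h2 h3 h4 h5
    have h6 : s(x1,y1) ∉ insert s(x2,y2) K := by
      rw [Finset.mem_insert]; tauto
    have : ex n d (fun G => fe q G s(x1,y1) * (fe q G s(x2,y2) * fH q G K)) =
        mu n d q (insert s(x1,y1) (insert s(x2,y2) K)) := by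
      apply ex_congr; intro G _
      rw [fH_insert q G h6, fH_insert q G h3]
    rw [this]
    have c2 : (insert s(x1,y1) (insert s(x2,y2) K)).card = K.card + 2 := by
      rw [Finset.card_insert_of_notMem h6, Finset.card_insert_of_notMem h3]
    have := hyp _ (simple_insert (simple_insert hK h2) h1) (by omega)
    rwa [c2] at this
  have hβ1' : T * β (H.card + 1) ≤ τ * (T * β H.card) := by
    have := mul_le_mul_of_nonneg_left (hβ1 H.card) hT; linarith
  have hβ2' : T * β (H.card + 2) ≤ τ^2 * (T * β H.card) := by
    have h1 := mul_le_mul_of_nonneg_left (hβ1 (H.card+1)) hT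
    have h2 := mul_le_mul_of_nonneg_left hβ1' hτ
    have : T * β (H.card + 1 + 1) = T * β (H.card + 2) := rfl
    nlinarith
  have A8 : |∑ x ∈ Wᶜ, ex n d (fun G => fe q G s(a,x) * (fe q G s(b',x) * g G))| ≤ N * (τ * (T * β H.card)) := by
    refine (Finset.abs_sum_le_sum_abs _ _).trans ?_
    rw [hN, ← nsmul_eq_mul]
    apply Finset.sum_le_card_nsmul
    intro x hx
    obtain ⟨h1, h2, h3, h4⟩ := hWn x hx
    refine (two (H.erase s(a,b')) a x b' x hHe (by omega) h1.symm h2.symm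
      (fun h => h4 _ (Finset.mem_of_mem_erase h)) (fun h => h4 _ (Finset.mem_of_mem_erase h))
      (by simp; grind)).trans ?_
    have : (H.erase s(a,b')).card + 2 = H.card + 1 := by omega
    rw [this]; exact hβ1'
  have A9 : |∑ x ∈ Wᶜ, ∑ y ∈ Wᶜ.erase x, (ex n d (fun G => fe q G s(x,y) * (fe q G s(a,x) * fH q G H))
        + ex n d (fun G => fe q G s(x,y) * (fe q G s(b',y) * fH q G H))
        - ex n d (fun G => fe q G s(a,x) * (fe q G s(b',y) * fH q G H))
        - ex n d (fun G => fe q G s(x,y) * (fe q G s(a,x) * (fe q G s(b',y) * g G))))|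
      ≤ N * (N * (4 * (τ^2 * (T * β H.card)))) := by
    refine (Finset.abs_sum_le_sum_abs _ _).trans ?_
    rw [hN, ← nsmul_eq_mul]
    apply Finset.sum_le_card_nsmul
    intro x hx
    obtain ⟨h1, h2, h3, h4⟩ := hWn x hx
    refine (Finset.abs_sum_le_sum_abs _ _).trans ?_
    have hpos : 0 ≤ 4 * (τ^2 * (T * β H.card)) := by have := hTb H.card; positivity
    refine le_trans (Finset.sum_le_card_nsmul _ _ (4 * (τ^2 * (T * β H.card))) ?_) ?_
    · intro y hy
      obtain ⟨hyx, hy⟩ := Finset.mem_erase.1 hy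
      obtain ⟨k1, k2, k3, k4⟩ := hWn y hy
      have b1 := (two H x y a x hH hL hyx.symm h1.symm (h4 _) (h3 _) (by simp; grind)).trans hβ2'
      have b2 := (two H x y b' y hH hL hyx.symm k2.symm (k4 _) (h3 _) (by simp; grind)).trans hβ2'
      have b3 := (two H a x b' y hH hL h1.symm k2.symm (k4 _) (h4 _) (by simp; grind)).trans hβ2'
      have hb4 : s(b',y) ∉ H.erase s(a,b') := fun h => k4 _ (Finset.mem_of_mem_erase h)
      have b4 : |ex n d (fun G => fe q G s(x,y) * (fe q G s(a,x) * (fe q G s(b',y) * g G)))| ≤ τ^2 * (T * β H.card) := by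
        have hcard : (insert s(b',y) (H.erase s(a,b'))).card = H.card := by
          rw [Finset.card_insert_of_notMem hb4, hc]
        have := two (insert s(b',y) (H.erase s(a,b'))) x y a x (simple_insert hHe k2.symm) (by omega)
          hyx.symm h1.symm
          (by
            rw [Finset.mem_insert]; rintro (h | h)
            · simp at h; grind
            · exact h4 _ (Finset.mem_of_mem_erase h))
          (by
            rw [Finset.mem_insert]; rintro (h | h)
            · simp at h; grind
            · exact h3 _ (Finset.mem_of_mem_erase h)) (by simp; grind)
        rw [hcard] at this
        refine le_trans (le_of_eq ?_) (this.trans hβ2')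
        congr 1
        apply ex_congr; intro G _
        rw [fH_insert q G hb4]
      rw [abs_le] at b1 b2 b3 b4 ⊢
      constructor <;> linarith [b1.1, b1.2, b2.1, b2.2, b3.1, b3.2, b4.1, b4.2]
    · rw [nsmul_eq_mul]
      apply mul_le_mul_of_nonneg_right _ hpos
      exact_mod_cast Finset.card_le_card (Finset.erase_subset _ _)
  have hlhs : q * N * (N - 1) * |mu n d q H| = |q * N * (N - 1) * mu n d q H| := by
    rw [abs_mul, abs_of_nonneg (mul_nonneg (mul_nonneg hq0.le (by linarith)) (by linarith))]
  rw [hlhs, hL1]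
  exact contr_arith hq0 hq1 hb hN1 (hTb _) A1 A2 A3 A4 A5 A6 A7 A8 A9
end GMP

namespace GMP
open GM

lemma ind_nonneg {n : ℕ} (G : Graph n) (e) : 0 ≤ ind G e := by unfold ind; split_ifs <;> norm_num
lemma ind_le_one {n : ℕ} (G : Graph n) (e) : ind G e ≤ 1 := by unfold ind; split_ifs <;> norm_num
lemma ind_diag {n d : ℕ} {G : Graph n} (hG : G ∈ regularGraphs n d) (u : Fin n) : ind G s(u,u) = 0 := by
  unfold ind
  rw [if_neg]
  intro h
  exact (mem_reg.1 hG).1 _ h (by simp)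

lemma sum_ind' {n d : ℕ} {G : Graph n} (hG : G ∈ regularGraphs n d) (u : Fin n) :
    ∑ v, ind G s(v,u) = d := by
  rw [← sum_ind hG u]; apply Finset.sum_congr rfl; intro v _; rw [Sym2.eq_swap]

def iH {n : ℕ} (G : Graph n) (H : Finset (Sym2 (Fin n))) : ℝ := ∏ e ∈ H, ind G e

lemma iH_abs {n : ℕ} (G : Graph n) (H : Finset (Sym2 (Fin n))) : iH G H = |fH 0 G H| := by
  unfold iH fH
  rw [Finset.abs_prod]
  apply Finset.prod_congr rfl
  intro e _
  unfold ind fe; split_ifs <;> simp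

lemma iH_nonneg {n : ℕ} (G : Graph n) (H : Finset (Sym2 (Fin n))) : 0 ≤ iH G H := by
  rw [iH_abs]; exact abs_nonneg _

lemma low_count {n d : ℕ} {G : Graph n} (hG : G ∈ regularGraphs n d) (W : Finset (Fin n)) (a b : Fin n) :
    (n:ℝ) * d - 2 * W.card * d - 2 * d^2 ≤
    ∑ x ∈ Wᶜ, ∑ y ∈ Wᶜ.erase x, ind G s(x,y) * (1 - ind G s(a,x)) * (1 - ind G s(b,y)) := by
  have h0 : ∀ x ∈ Wᶜ, ∑ y ∈ Wᶜ.erase x, ind G s(x,y) * (1 - ind G s(a,x)) * (1 - ind G s(b,y))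
      = ∑ y ∈ Wᶜ, ind G s(x,y) * (1 - ind G s(a,x)) * (1 - ind G s(b,y)) := by
    intro x _
    apply Finset.sum_erase
    rw [ind_diag hG]; ring
  rw [Finset.sum_congr rfl h0]
  have h1 : ∑ x ∈ Wᶜ, ∑ y ∈ Wᶜ, (ind G s(x,y) - ind G s(x,y) * ind G s(a,x) - ind G s(x,y) * ind G s(b,y))
      ≤ ∑ x ∈ Wᶜ, ∑ y ∈ Wᶜ, ind G s(x,y) * (1 - ind G s(a,x)) * (1 - ind G s(b,y)) := by
    apply Finset.sum_le_sum; intro x _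
    apply Finset.sum_le_sum; intro y _
    have := mul_nonneg (mul_nonneg (ind_nonneg G s(x,y)) (ind_nonneg G s(a,x))) (ind_nonneg G s(b,y))
    nlinarith
  refine le_trans ?_ h1
  simp_rw [Finset.sum_sub_distrib]
  have e1 : ∑ x ∈ Wᶜ, ∑ y ∈ Wᶜ, ind G s(x,y) ≥ n * d - 2 * W.card * d := by
    have a1 : ∑ x : Fin n, ∑ y : Fin n, ind G s(x,y) = n * d := by
      simp_rw [sum_ind hG]; simp
    have a2 : ∑ x ∈ W, ∑ y : Fin n, ind G s(x,y) = W.card * d := by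
      simp_rw [sum_ind hG]; simp
    have a3 : ∑ x ∈ Wᶜ, ∑ y ∈ W, ind G s(x,y) ≤ W.card * d := by
      rw [Finset.sum_comm]
      calc _ ≤ ∑ y ∈ W, ∑ x, ind G s(x,y) := by
            apply Finset.sum_le_sum; intro y _
            exact Finset.sum_le_sum_of_subset_of_nonneg (Finset.subset_univ _) (fun _ _ _ => ind_nonneg _ _)
        _ = _ := by simp_rw [sum_ind' hG]; simp
    have a4 := Finset.sum_add_sum_compl W (fun x => ∑ y : Fin n, ind G s(x,y))
    have a5 : ∑ x ∈ Wᶜ, ∑ y : Fin n, ind G s(x,y) = ∑ x ∈ Wᶜ, ∑ y ∈ W, ind G s(x,y) + ∑ x ∈ Wᶜ, ∑ y ∈ Wᶜ, ind G s(x,y) := by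
      rw [← Finset.sum_add_distrib]
      apply Finset.sum_congr rfl; intro x _
      exact (Finset.sum_add_sum_compl W _).symm
    linarith
  have ext1 : ∀ F : Fin n → Fin n → ℝ, (∀ x y, 0 ≤ F x y) → ∑ x ∈ Wᶜ, ∑ y ∈ Wᶜ, F x y ≤ ∑ x, ∑ y, F x y := by
    intro F hF
    calc _ ≤ ∑ x ∈ Wᶜ, ∑ y, F x y := by
            apply Finset.sum_le_sum; intro y _
            exact Finset.sum_le_sum_of_subset_of_nonneg (Finset.subset_univ _) (fun _ _ _ => hF _ _)
      _ ≤ _ := Finset.sum_le_sum_of_subset_of_nonneg (Finset.subset_univ _)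
            (fun _ _ _ => Finset.sum_nonneg (fun _ _ => hF _ _))
  have e2 : ∑ x ∈ Wᶜ, ∑ y ∈ Wᶜ, ind G s(x,y) * ind G s(a,x) ≤ d^2 := by
    refine (ext1 _ (fun x y => mul_nonneg (ind_nonneg _ _) (ind_nonneg _ _))).trans (le_of_eq ?_)
    simp_rw [← Finset.sum_mul, sum_ind hG, ← Finset.mul_sum, sum_ind hG]; ring
  have e3 : ∑ x ∈ Wᶜ, ∑ y ∈ Wᶜ, ind G s(x,y) * ind G s(b,y) ≤ d^2 := by
    refine (ext1 _ (fun x y => mul_nonneg (ind_nonneg _ _) (ind_nonneg _ _))).trans (le_of_eq ?_)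
    rw [Finset.sum_comm]
    simp_rw [← Finset.sum_mul, sum_ind' hG, ← Finset.mul_sum, sum_ind hG]; ring
  linarith

lemma up_count {n d : ℕ} {G : Graph n} (hG : G ∈ regularGraphs n d) (W : Finset (Fin n)) (a b : Fin n) :
    ∑ x ∈ Wᶜ, ∑ y ∈ Wᶜ.erase x, ind G s(a,x) * ind G s(b,y) ≤ (d:ℝ)^2 := by
  calc _ ≤ ∑ x ∈ Wᶜ, ∑ y, ind G s(a,x) * ind G s(b,y) := by
            apply Finset.sum_le_sum; intro y _
            exact Finset.sum_le_sum_of_subset_of_nonneg (Finset.subset_univ _)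
              (fun _ _ _ => mul_nonneg (ind_nonneg _ _) (ind_nonneg _ _))
      _ ≤ ∑ x, ∑ y, ind G s(a,x) * ind G s(b,y) := Finset.sum_le_sum_of_subset_of_nonneg (Finset.subset_univ _)
            (fun _ _ _ => Finset.sum_nonneg (fun _ _ => mul_nonneg (ind_nonneg _ _) (ind_nonneg _ _)))
      _ = _ := by
        simp_rw [← Finset.mul_sum, ← Finset.sum_mul, sum_ind hG]; ring

lemma crude_step {n d : ℕ} {H : Finset (Sym2 (Fin n))} (hH : SimpleE H) {a b : Fin n} (he : s(a,b) ∈ H) :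
    ((n:ℝ) * d - 2 * (vertsOf H).card * d - 2 * d^2) * ex n d (fun G => iH G H) ≤
      d^2 * ex n d (fun G => iH G (H.erase s(a,b))) := by
  set W := vertsOf H with hW
  have hab : a ≠ b := by simpa using hH _ he
  have haW := (mem_verts he).1
  have hbW := (mem_verts he).2
  have hiH : ∀ G : Graph n, iH G H = ind G s(a,b) * iH G (H.erase s(a,b)) := by
    intro G; unfold iH; rw [Finset.mul_prod_erase _ _ he]
  set g : Graph n → ℝ := fun G => iH G (H.erase s(a,b)) with hg
  have hg0 : ∀ G, 0 ≤ g G := fun G => iH_nonneg _ _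
  calc ((n:ℝ) * d - 2 * (vertsOf H).card * d - 2 * d^2) * ex n d (fun G => iH G H)
      = ∑ G ∈ regularGraphs n d, ((n:ℝ) * d - 2 * W.card * d - 2 * d^2) * (ind G s(a,b) * g G) := by
        unfold ex; rw [Finset.mul_sum]; simp_rw [hiH, hW]; rfl
    _ ≤ ∑ G ∈ regularGraphs n d, (∑ x ∈ Wᶜ, ∑ y ∈ Wᶜ.erase x, ind G s(x,y) * (1 - ind G s(a,x)) * (1 - ind G s(b,y))) * (ind G s(a,b) * g G) := by
        apply Finset.sum_le_sum; intro G hG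
        exact mul_le_mul_of_nonneg_right (low_count hG W a b) (mul_nonneg (ind_nonneg _ _) (hg0 G))
    _ = ∑ x ∈ Wᶜ, ∑ y ∈ Wᶜ.erase x, ∑ G ∈ regularGraphs n d, ind G s(a,b) * ind G s(x,y) * (1 - ind G s(a,x)) * (1 - ind G s(b,y)) * g G := by
        simp_rw [Finset.sum_mul]
        rw [Finset.sum_comm]
        apply Finset.sum_congr rfl; intro x _
        rw [Finset.sum_comm]
        apply Finset.sum_congr rfl; intro y _
        apply Finset.sum_congr rfl; intro G _
        ring
    _ = ∑ x ∈ Wᶜ, ∑ y ∈ Wᶜ.erase x, ∑ G ∈ regularGraphs n d, ind G s(a,x) * ind G s(b,y) * (1 - ind G s(a,b)) * (1 - ind G s(x,y)) * g G := by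
        apply Finset.sum_congr rfl; intro x hx
        apply Finset.sum_congr rfl; intro y hy
        obtain ⟨hyx, hy⟩ := Finset.mem_erase.1 hy
        rw [Finset.mem_compl] at hx hy
        apply switching hab (by rintro rfl; exact hx haW) (by rintro rfl; exact hy haW)
          (by rintro rfl; exact hx hbW) (by rintro rfl; exact hy hbW) hyx.symm
        intro G
        simp only [hg, iH_abs]
        rw [fH_sw 0 G]
        · simp
        · exact fun h => notin_of_verts hx (Finset.mem_of_mem_erase h)
        · exact fun h => notin_of_verts' hx (Finset.mem_of_mem_erase h)
        · exact fun h => notin_of_verts' hy (Finset.mem_of_mem_erase h)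
    _ ≤ ∑ x ∈ Wᶜ, ∑ y ∈ Wᶜ.erase x, ∑ G ∈ regularGraphs n d, ind G s(a,x) * ind G s(b,y) * g G := by
        apply Finset.sum_le_sum; intro x _
        apply Finset.sum_le_sum; intro y _
        apply Finset.sum_le_sum; intro G _
        apply mul_le_mul_of_nonneg_right _ (hg0 G)
        have h0 := mul_nonneg (ind_nonneg G s(a,x)) (ind_nonneg G s(b,y))
        have h1 : 0 ≤ 1 - ind G s(x,y) := by linarith [ind_le_one G s(x,y)]
        have h2 : 0 ≤ 1 - ind G s(a,b) := by linarith [ind_le_one G s(a,b)]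
        have h3 := mul_le_of_le_one_right h0 (by linarith [ind_nonneg G s(a,b)] : 1 - ind G s(a,b) ≤ 1)
        exact (mul_le_of_le_one_right (mul_nonneg h0 h2) (by linarith [ind_nonneg G s(x,y)])).trans h3
    _ = ∑ G ∈ regularGraphs n d, (∑ x ∈ Wᶜ, ∑ y ∈ Wᶜ.erase x, ind G s(a,x) * ind G s(b,y)) * g G := by
        simp_rw [Finset.sum_mul]
        symm
        rw [Finset.sum_comm]
        apply Finset.sum_congr rfl; intro x _
        rw [Finset.sum_comm]
    _ ≤ ∑ G ∈ regularGraphs n d, (d:ℝ)^2 * g G := by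
        apply Finset.sum_le_sum; intro G hG
        exact mul_le_mul_of_nonneg_right (up_count hG W a b) (hg0 G)
    _ = _ := by unfold ex; rw [Finset.mul_sum]

lemma card_verts_le {n : ℕ} (H : Finset (Sym2 (Fin n))) : (vertsOf H).card ≤ 2 * H.card := by
  have : vertsOf H ⊆ H.biUnion (fun e => e.toFinset) := by
    intro v hv
    simp [vertsOf] at hv
    simpa using hv
  refine (Finset.card_le_card this).trans (Finset.card_biUnion_le.trans ?_)
  rw [mul_comm]
  apply Finset.sum_le_card_nsmul
  intro e _
  by_cases h : e.IsDiag
  · rw [Sym2.card_toFinset_of_isDiag e h]; norm_num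
  · rw [Sym2.card_toFinset_of_not_isDiag e h]

lemma crude_c {n d : ℕ} (hd : 0 < d) (L : ℕ) (hL : 8 * L + 4 * d ≤ n) :
    ∀ m, m ≤ L → ∀ H : Finset (Sym2 (Fin n)), SimpleE H → H.card = m →
    ex n d (fun G => iH G H) ≤ (regularGraphs n d).card * (2 * d / n : ℝ)^m := by
  intro m
  induction m with
  | zero =>
    intro _ H _ hc
    rw [Finset.card_eq_zero] at hc
    subst hc
    simp [ex, iH]
  | succ m ih =>
    intro hm H hH hc
    have hne : H.Nonempty := by rw [← Finset.card_pos]; omega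
    obtain ⟨e, he⟩ := hne
    induction e using Sym2.ind with
    | h a b =>
    have h1 := crude_step (d := d) hH he
    have hce : (H.erase s(a,b)).card = m := by rw [Finset.card_erase_of_mem he]; omega
    have h2 := ih (by omega) _ (simple_erase hH _) hce
    have hw : ((vertsOf H).card : ℝ) ≤ 2 * L := by
      have := card_verts_le H
      have : (vertsOf H).card ≤ 2 * L := by omega
      exact_mod_cast this
    have hn : (8 * L + 4 * d : ℝ) ≤ n := by exact_mod_cast hL
    have hd' : (0:ℝ) < d := by exact_mod_cast hd
    have hn0 : (0:ℝ) < n := by have : (0:ℝ) ≤ L := by positivity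
                               linarith
    set c := ex n d (fun G => iH G H)
    have hc0 : 0 ≤ c := Finset.sum_nonneg (fun G _ => iH_nonneg _ _)
    have h3 : (n * d / 2 : ℝ) * c ≤ d^2 * ex n d (fun G => iH G (H.erase s(a,b))) := by
      refine le_trans (mul_le_mul_of_nonneg_right ?_ hc0) h1
      nlinarith
    have h4 : (n * d / 2 : ℝ) * c ≤ d^2 * ((regularGraphs n d).card * (2 * d / n : ℝ)^m) :=
      h3.trans (mul_le_mul_of_nonneg_left h2 (by positivity))
    have h5 : d^2 * ((regularGraphs n d).card * (2 * d / n : ℝ)^m) = (n * d / 2 : ℝ) * ((regularGraphs n d).card * (2 * d / n : ℝ)^(m+1)) := by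
      rw [pow_succ (2 * d / n : ℝ) m]
      generalize (2 * d / n : ℝ)^m = x
      field_simp
    rw [h5] at h4
    exact le_of_mul_le_mul_left h4 (by positivity)

lemma crude {n d : ℕ} (hd : 0 < d) (L : ℕ) (hL : 8 * L + 4 * d ≤ n) {q : ℝ} (hq0 : 0 ≤ q)
    (hqd : q ≤ 2 * d / n) (H : Finset (Sym2 (Fin n))) (hH : SimpleE H) (hc : H.card ≤ L) :
    |mu n d q H| ≤ (regularGraphs n d).card * (4 * d / n : ℝ)^H.card := by
  have h1 : ∀ G : Graph n, |fH q G H| ≤ ∑ S ∈ H.powerset, iH G S * ∏ e ∈ H \ S, q := by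
    intro G
    unfold fH iH
    rw [← Finset.prod_add, Finset.abs_prod]
    apply Finset.prod_le_prod (fun _ _ => abs_nonneg _)
    intro e _
    unfold fe ind
    split_ifs
    · simp; exact hq0
    · simp [abs_of_nonneg hq0]
  have hsum : |mu n d q H| ≤ ∑ S ∈ H.powerset, ex n d (fun G => iH G S) * ∏ e ∈ H \ S, q := by
    refine (Finset.abs_sum_le_sum_abs _ _).trans ((Finset.sum_le_sum (fun G _ => h1 G)).trans (le_of_eq ?_))
    rw [Finset.sum_comm]
    apply Finset.sum_congr rfl; intro S _
    unfold ex; rw [Finset.sum_mul]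
  refine hsum.trans ?_
  calc _ ≤ ∑ S ∈ H.powerset, ((regularGraphs n d).card * (∏ e ∈ S, (2 * d / n : ℝ))) * ∏ e ∈ H \ S, q := by
        apply Finset.sum_le_sum
        intro S hS
        rw [Finset.mem_powerset] at hS
        apply mul_le_mul_of_nonneg_right _ (Finset.prod_nonneg (fun _ _ => hq0))
        rw [Finset.prod_const]
        exact crude_c hd L hL _ ((Finset.card_le_card hS).trans hc) S (fun e he => hH e (hS he)) rfl
    _ = (regularGraphs n d).card * ∏ e ∈ H, (2 * d / n + q : ℝ) := by
        rw [Finset.prod_add, Finset.mul_sum]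
        apply Finset.sum_congr rfl; intro S _; ring
    _ ≤ _ := by
        rw [Finset.prod_const]
        apply mul_le_mul_of_nonneg_left _ (by positivity)
        apply pow_le_pow_left₀ (by positivity)
        have : (4 * d / n : ℝ) = 2 * d / n + 2 * d / n := by ring
        linarith
end GMP

namespace GMP
open GM

lemma bootstrap {n d : ℕ} {q b τ : ℝ} (β : ℕ → ℝ) (hq : q * ((n:ℝ) - d) = d)
    (hq0 : 0 < q) (hq1 : q ≤ 1) (hb : 0 < b) (hτ : 0 ≤ τ)
    (hβ : ∀ e, 0 < β e) (hβ0 : β 0 = 1) (hβ1 : ∀ e, β (e+1) ≤ τ * β e) (hβ2 : ∀ e, b * β e ≤ β (e+1))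
    (L : ℕ) (hcr : ∀ H : Finset (Sym2 (Fin n)), SimpleE H → L < H.card → H.card ≤ L + 2 →
      |mu n d q H| ≤ (regularGraphs n d).card * β H.card)
    (hcon : ∀ H : Finset (Sym2 (Fin n)), SimpleE H → H.Nonempty → H.card ≤ L →
      ∃ θ : ℝ, 0 ≤ θ ∧ (vertsOf H).card * τ + q + (L + 2) * (1 + q / b) ≤ θ ∧ ∃ N : ℝ,
        N = ((vertsOf H)ᶜ).card ∧ 2 ≤ N ∧
        2 * q * (N - 1) * (θ / b) + q * ((vertsOf H).card * θ + q * N) / b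
        + ((vertsOf H).card * θ + q * N) + (θ^2 / b + N * τ) + 4 * N^2 * τ^2 ≤ q * N * (N - 1) / 2)
    (H : Finset (Sym2 (Fin n))) (hH : SimpleE H) (hL : H.card ≤ L + 2) :
    |mu n d q H| ≤ (regularGraphs n d).card * β H.card := by
  set S : Finset (Finset (Sym2 (Fin n))) := Finset.univ.filter (fun H => SimpleE H ∧ H.card ≤ L + 2) with hS
  have hSne : S.Nonempty := ⟨H, by simp [hS, hH, hL]⟩
  obtain ⟨M, hM, hmax⟩ := Finset.exists_max_image S (fun H => |mu n d q H| / β H.card) hSne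
  set T := |mu n d q M| / β M.card with hT
  have hT0 : 0 ≤ T := div_nonneg (abs_nonneg _) (hβ _).le
  have hyp : ∀ H : Finset (Sym2 (Fin n)), SimpleE H → H.card ≤ L + 2 → |mu n d q H| ≤ T * β H.card := by
    intro H hH hL
    have := hmax H (by simp [hS, hH, hL])
    rwa [← div_le_iff₀ (hβ _)]
  obtain ⟨hMs, hMc⟩ : SimpleE M ∧ M.card ≤ L + 2 := by simpa [hS] using hM
  have hTZ : T ≤ (regularGraphs n d).card := by
    by_cases h0 : M.Nonempty
    · by_cases h1 : M.card ≤ L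
      · obtain ⟨θ, hθ0, hθ, N, hN, hN2, hfin⟩ := hcon M hMs h0 h1
        have := contraction β hq hq0 hq1 hb hτ hT0 hθ0 (fun e => (hβ e).le) hβ1 hβ2 L hyp M hMs h1 h0 hθ N hN hN2
        have h2 : q * N * (N-1) * |mu n d q M| ≤ (q * N * (N - 1) / 2) * (T * β M.card) :=
          this.trans (mul_le_mul_of_nonneg_right hfin (mul_nonneg hT0 (hβ _).le))
        have hpos : 0 < q * N * (N-1) := by
          have : 0 < N - 1 := by linarith
          have : 0 < N := by linarith
          positivity
        have h3 : |mu n d q M| = T * β M.card := by rw [hT, div_mul_cancel₀ _ (hβ _).ne']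
        rw [h3] at h2
        have h4 : T * β M.card ≤ 0 := by
          by_contra hc
          push Not at hc
          nlinarith [mul_pos hpos hc]
        have h5 : T ≤ 0 := by
          by_contra hc
          push Not at hc
          nlinarith [mul_pos hc (hβ M.card)]
        exact h5.trans (Nat.cast_nonneg _)
      · rw [hT, div_le_iff₀ (hβ _)]
        exact hcr M hMs (by omega) hMc
    · rw [Finset.not_nonempty_iff_eq_empty] at h0
      rw [hT, h0]
      simp [mu, fH, hβ0]
  exact (hyp H hH hL).trans (mul_le_mul_of_nonneg_right hTZ (hβ _).le)

set_option maxHeartbeats 1000000 in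
/-- numeric contraction -/
lemma num_contr {n q b τ r s v w N θ L ν : ℝ} (hν : 10000 ≤ ν) (hn : n = ν^40) (hr1 : 1 ≤ r) (hrν : r ≤ ν^10)
    (hs2 : 1 ≤ s) (hsν : s ≤ ν^2) (hv2 : 2 ≤ v) (hvs : v ≤ s * r) (hvν : v ≤ ν^3)
    (hq1 : r^2 / n ≤ q) (hq2 : q ≤ 2 * r^2 / n) (hb : b = 10000 * v * s^3 * r / n)
    (hτ : τ = ν^9 * r^2 / n) (hw0 : 0 ≤ w) (hw : w ≤ 6 * v^2) (hL : L = 3 * v^2)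
    (hN : N = n - w) (hθ : θ = 6 * v^2 * τ + q + (L + 2) * (1 + q / b)) :
    0 ≤ θ ∧ 2 ≤ N ∧ 2 * q * (N - 1) * (θ / b) + q * (w * θ + q * N) / b
        + (w * θ + q * N) + (θ^2 / b + N * τ) + 4 * N^2 * τ^2 ≤ q * N * (N - 1) / 2 := by
  have hν0 : 0 < ν := by linarith
  have hν1 : 1 ≤ ν := by linarith
  have pw : ∀ i j : ℕ, i ≤ j → ν^i ≤ ν^j := fun i j h => pow_le_pow_right₀ hν1 h
  have hn0 : 0 < n := by rw [hn]; positivity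
  have hr0 : 0 < r := by linarith
  have hs0 : 0 < s := by linarith
  have hv0 : 0 < v := by linarith
  have hb0 : 0 < b := by rw [hb]; positivity
  have hq0 : 0 < q := lt_of_lt_of_le (by positivity) hq1
  have hτ0 : 0 < τ := by rw [hτ]; positivity
  have hr2 : r^2 ≤ ν^20 := by
    calc r^2 ≤ (ν^10)^2 := by gcongr
      _ = _ := by ring
  have hv2' : v^2 ≤ ν^6 := by
    calc v^2 ≤ (ν^3)^2 := by gcongr
      _ = _ := by ring
  have hs3 : 1 ≤ s^3 := one_le_pow₀ hs2
  have hs22 : s ≤ s^3 := le_self_pow₀ hs2 (by norm_num)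
  have big : ∀ i j : ℕ, i < j → 10000 * ν^i ≤ ν^j := by
    intro i j h
    calc 10000 * ν^i ≤ ν * ν^i := by gcongr
      _ = ν^(i+1) := by ring
      _ ≤ _ := pw _ _ h
  have h1ν : ∀ j : ℕ, 0 < j → 10000 ≤ ν^j := by
    intro j h; simpa using big 0 j h
  have hτs : τ ≤ 1 / 100 / v^2 := by
    rw [hτ, hn, div_le_div_iff₀ (by positivity) (by positivity)]
    calc ν^9 * r^2 * v^2 ≤ ν^9 * ν^20 * ν^6 := by gcongr
      _ = ν^35 := by ring
      _ ≤ _ := by have := big 35 40 (by norm_num); nlinarith [pow_pos hν0 35]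
  have hτv : v^2 * τ ≤ 1/100 := by
    have := mul_le_mul_of_nonneg_left hτs (sq_nonneg v)
    rwa [mul_div_cancel₀ _ (by positivity)] at this
  have hqs : q ≤ 1/100 := by
    refine hq2.trans ?_
    rw [hn, div_le_div_iff₀ (by positivity) (by positivity)]
    have := big 20 40 (by norm_num)
    nlinarith
  have hbn : b * n = 10000 * v * s^3 * r := by rw [hb]; field_simp
  have hqn1 : r^2 ≤ q * n := by rwa [div_le_iff₀ hn0] at hq1
  have hqn2 : q * n ≤ 2 * r^2 := by rwa [le_div_iff₀ hn0] at hq2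
  have hU : q / b ≤ r / (5000 * v * s^3) := by
    rw [div_le_div_iff₀ hb0 (by positivity)]
    have : q * (5000 * v * s^3) * n ≤ r * b * n := by
      calc q * (5000 * v * s^3) * n = (q * n) * (5000 * v * s^3) := by ring
        _ ≤ 2 * r^2 * (5000 * v * s^3) := by gcongr
        _ = r * (b * n) := by rw [hbn]; ring
        _ = _ := by ring
    exact le_of_mul_le_mul_right this hn0
  have hU0 : 0 ≤ q / b := by positivity
  have hvU : v * (q / b) ≤ r / 5000 := by
    calc v * (q / b) ≤ v * (r / (5000 * v * s^3)) := by gcongr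
      _ = r / 5000 / s^3 := by field_simp
      _ ≤ _ := div_le_self (by positivity) hs3
  have hθ0 : 0 ≤ θ := by
    rw [hθ, hL]; positivity
  have hvv : v^2 ≤ v * s * r := by nlinarith
  have hθ6 : θ ≤ 6 * v * s * r := by
    have h1 : (L + 2) * (q / b) ≤ 4 * v^2 * (q / b) := by
      apply mul_le_mul_of_nonneg_right _ hU0
      rw [hL]; nlinarith
    have h2 : 4 * v^2 * (q / b) ≤ v * r := by
      calc 4 * v^2 * (q / b) = 4 * v * (v * (q/b)) := by ring
        _ ≤ 4 * v * (r / 5000) := by gcongr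
        _ = v * r * (4/5000) := by ring
        _ ≤ _ := mul_le_of_le_one_right (by positivity) (by norm_num)
    have h3 : v * r ≤ v * s * r := by
      calc v * r = v * 1 * r := by ring
        _ ≤ _ := by gcongr
    have h4 : (L + 2) * (1 + q / b) = L + 2 + (L+2) * (q / b) := by ring
    have h5 : 4 ≤ v^2 := by nlinarith
    rw [hθ, h4]
    linarith
  have hn6 : 10000 * ν^10 ≤ n := by rw [hn]; exact big 10 40 (by norm_num)
  have hvn : 10000 * v^2 ≤ n := by
    have := pw 6 10 (by norm_num); linarith
  have hν10 := h1ν 10 (by norm_num)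
  have hNl : n / 2 + 1 ≤ N - 1 := by rw [hN]; linarith
  have hNu : N ≤ n := by rw [hN]; linarith
  have hN0 : 0 < N := by linarith
  have hN10 : 0 < N - 1 := by linarith
  have hNN : N ≤ 2 * (N - 1) := by linarith
  have hθb : θ / b ≤ n / 40 := by
    rw [div_le_div_iff₀ hb0 (by norm_num)]
    have : n * b = b * n := by ring
    rw [this, hbn]
    have : v * r * s ≤ v * r * s^3 := by gcongr
    have := mul_pos (mul_pos hv0 hr0) hs0
    linarith
  have hqM : n^2 / 4 * (r^2 / n) ≤ q * N * (N-1) := by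
    have : n^2/4 ≤ N * (N-1) := by
      calc n^2/4 = (n/2) * (n/2) := by ring
        _ ≤ _ := mul_le_mul (by linarith) (by linarith) (by positivity) hN0.le
    calc n^2 / 4 * (r^2 / n) ≤ (N * (N-1)) * q := by gcongr
      _ = _ := by ring
  have hqM' : n * r^2 / 4 ≤ q * N * (N-1) := by
    refine le_trans (le_of_eq ?_) hqM
    field_simp
  have T1 : 2 * q * (N - 1) * (θ / b) ≤ (1/10) * (q * N * (N-1)) := by
    calc 2 * q * (N - 1) * (θ / b) ≤ 2 * q * (N - 1) * (N / 20) := by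
          exact mul_le_mul_of_nonneg_left (by linarith) (by positivity)
      _ = _ := by ring
  have T2 : q * (w * θ) / b ≤ (1/10) * (q * N * (N-1)) := by
    calc q * (w * θ) / b = q * w * (θ / b) := by ring
      _ ≤ q * (N-1) * (N / 10) := by
          exact mul_le_mul (mul_le_mul_of_nonneg_left (by linarith) hq0.le) (by linarith) (by positivity) (by positivity)
      _ = _ := by ring
  have T2' : q * (q * N) / b ≤ (1/20) * (q * N * (N-1)) := by
    calc q * (q * N) / b = q * N * (q / b) := by ring
      _ ≤ q * N * ((N - 1) / 20) := by
          apply mul_le_mul_of_nonneg_left _ (by positivity)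
          have h1 : r ≤ n := by
            rw [hn]; exact hrν.trans (pw _ _ (by norm_num))
          have h2 : q / b ≤ v * (q / b) := le_mul_of_one_le_left hU0 (by linarith)
          linarith
      _ = _ := by ring
  have hsν2 : s^2 ≤ ν^4 := by
    calc s^2 ≤ (ν^2)^2 := by gcongr
      _ = _ := by ring
  have T3 : w * θ ≤ (1/20) * (q * N * (N-1)) := by
    have : w * θ ≤ n * r^2 / 80 := by
      calc w * θ ≤ (6 * v^2) * (6 * v * s * r) := by gcongr
        _ = 36 * (v^2) * (v * s * r) := by ring
        _ ≤ 36 * v^2 * ((s * r) * s * r) := by gcongr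
        _ = 36 * (v^2 * s^2) * r^2 := by ring
        _ ≤ 36 * (ν^6 * ν^4) * r^2 := by gcongr
        _ = 36 * ν^10 * r^2 := by ring
        _ ≤ n / 80 * r^2 := by
            gcongr
            linarith [pow_pos hν0 10]
        _ = _ := by ring
    linarith
  have T3' : q * N ≤ (1/20) * (q * N * (N-1)) := by
    have := mul_le_mul_of_nonneg_left (by linarith : 20 ≤ N - 1) (mul_pos hq0 hN0).le
    linarith
  have T4 : θ^2 / b ≤ (1/20) * (q * N * (N-1)) := by
    have : θ^2 / b ≤ n * r^2 / 80 := by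
      rw [div_le_div_iff₀ hb0 (by norm_num)]
      have h1 : n * r^2 * b = r^2 * (10000 * v * s^3 * r) := by rw [← hbn]; ring
      rw [h1]
      calc θ^2 * 80 ≤ (6 * v * s * r)^2 * 80 := by gcongr
        _ = 2880 * (v * s^2 * r^2) * v := by ring
        _ ≤ 2880 * (v * s^2 * r^2) * (s * r) := by gcongr
        _ = 2880 * (v * s^3 * r^3) := by ring
        _ ≤ 10000 * (v * s^3 * r^3) := by gcongr; norm_num
        _ = _ := by ring
    linarith
  have T4' : N * τ ≤ (1/20) * (q * N * (N-1)) := by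
    have h9 : ν^9 * 40 ≤ n := by
      rw [hn]; have := big 9 40 (by norm_num); linarith [pow_pos hν0 9]
    have : τ ≤ q * n / 40 := by
      have h1 : τ ≤ r^2 / 40 := by
        rw [hτ, div_le_div_iff₀ hn0 (by norm_num)]
        have := mul_le_mul_of_nonneg_left h9 (sq_nonneg r)
        linarith
      linarith
    have h2 : τ ≤ q * (N-1) / 20 := by
      have := mul_le_mul_of_nonneg_left (by linarith : n / 2 ≤ N - 1) hq0.le
      linarith
    have := mul_le_mul_of_nonneg_left h2 hN0.le
    linarith
  have T5 : 4 * N^2 * τ^2 ≤ (1/20) * (q * N * (N-1)) := by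
    have h1 : 160 * τ^2 ≤ q := by
      refine le_trans ?_ hq1
      have : 160 * τ^2 = (160 * ν^18 * r^2 / n) * (r^2 / n) := by rw [hτ]; field_simp
      rw [this]
      apply mul_le_of_le_one_left (by positivity)
      rw [div_le_one hn0, hn]
      calc 160 * ν^18 * r^2 ≤ 160 * ν^18 * ν^20 := by gcongr
        _ = 160 * ν^38 := by ring
        _ ≤ _ := by have := big 38 40 (by norm_num); linarith [pow_pos hν0 38]
    calc 4 * N^2 * τ^2 = 4 * τ^2 * N * N := by ring
      _ ≤ 4 * τ^2 * N * (2 * (N-1)) := mul_le_mul_of_nonneg_left hNN (by positivity)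
      _ = (1/20) * ((160 * τ^2) * (N * (N-1))) := by ring
      _ ≤ (1/20) * (q * (N * (N-1))) := by
          apply mul_le_mul_of_nonneg_left _ (by norm_num)
          exact mul_le_mul_of_nonneg_right h1 (by positivity)
      _ = _ := by ring
  refine ⟨hθ0, by linarith, ?_⟩
  have split : q * (w * θ + q * N) / b = q * (w * θ) / b + q * (q * N) / b := by ring
  rw [split]
  linarith
end GMP

namespace GMP
open GM

def bet (b τ : ℝ) (E e : ℕ) : ℝ := b^(min e E) * τ^(e - E)

lemma bet_pos {b τ : ℝ} (hb : 0 < b) (hτ : 0 < τ) (E e : ℕ) : 0 < bet b τ E e := by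
  unfold bet; positivity

lemma bet_succ_le {b τ : ℝ} (hb : 0 < b) (hbτ : b ≤ τ) (E e : ℕ) : bet b τ E (e+1) ≤ τ * bet b τ E e := by
  have hτ : 0 < τ := lt_of_lt_of_le hb hbτ
  unfold bet
  by_cases h : e < E
  · rw [min_eq_left (by omega), min_eq_left (by omega), Nat.sub_eq_zero_of_le (by omega), Nat.sub_eq_zero_of_le (by omega)]
    rw [pow_succ]; simp
    rw [mul_comm]; gcongr
  · rw [min_eq_right (by omega), min_eq_right (by omega), Nat.sub_add_comm (by omega), pow_succ]
    apply le_of_eq; ring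

lemma bet_le_succ {b τ : ℝ} (hb : 0 < b) (hbτ : b ≤ τ) (E e : ℕ) : b * bet b τ E e ≤ bet b τ E (e+1) := by
  have hτ : 0 < τ := lt_of_lt_of_le hb hbτ
  unfold bet
  by_cases h : e < E
  · rw [min_eq_left (by omega), min_eq_left (by omega), Nat.sub_eq_zero_of_le (by omega), Nat.sub_eq_zero_of_le (by omega)]
    rw [pow_succ]; simp
    rw [mul_comm]
  · rw [min_eq_right (by omega), min_eq_right (by omega), Nat.sub_add_comm (by omega), pow_succ]
    have : b * (b^E * τ^(e-E)) ≤ τ * (b^E * τ^(e-E)) := by gcongr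
    refine this.trans (le_of_eq (by ring))

/-- the key moment bound -/
lemma key {n d v : ℕ} {q b r s ν : ℝ} (hν : 10000 ≤ ν) (hn : (n:ℝ) = ν^40) (hr1 : 1 ≤ r) (hrν : r ≤ ν^10)
    (hrd : r^2 = d) (hs2 : 1 ≤ s) (hsν : s ≤ ν^2) (hv2 : 2 ≤ v) (hvs : (v:ℝ) ≤ s * r) (hvν : (v:ℝ) ≤ ν^3)
    (hq : q * ((n:ℝ) - d) = d) (hb : b = 10000 * v * s^3 * r / n)
    (H : Finset (Sym2 (Fin n))) (hH : SimpleE H) (hL : H.card ≤ v^2) :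
    |mu n d q H| ≤ (regularGraphs n d).card * b^H.card := by
  have hν0 : 0 < ν := by linarith
  have hν1 : 1 ≤ ν := by linarith
  have hv2R : (2:ℝ) ≤ v := by exact_mod_cast hv2
  have hn0 : (0:ℝ) < n := by rw [hn]; positivity
  have hr0 : 0 < r := by linarith
  have hs0 : 0 < s := by linarith
  have hv0 : (0:ℝ) < v := by linarith
  have big : ∀ i j : ℕ, i < j → 10000 * ν^i ≤ ν^j := by
    intro i j h
    calc 10000 * ν^i ≤ ν * ν^i := by gcongr
      _ = ν^(i+1) := by ring
      _ ≤ _ := pow_le_pow_right₀ hν1 h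
  have hr2 : r^2 ≤ ν^20 := by
    calc r^2 ≤ (ν^10)^2 := by gcongr
      _ = _ := by ring
  have hd1 : (1:ℝ) ≤ d := by rw [← hrd]; exact one_le_pow₀ hr1
  have hd0 : 0 < d := by
    have : (0:ℝ) < d := by linarith
    exact_mod_cast this
  have hdn : 10000 * (d:ℝ) ≤ n := by
    rw [← hrd, hn]; have := big 20 40 (by norm_num); linarith
  have hnd : 0 < (n:ℝ) - d := by linarith
  have hqe : q = d / (n - d) := by rw [eq_div_iff hnd.ne']; exact hq
  have hq1 : r^2 / n ≤ q := by
    rw [hrd, hqe]; apply div_le_div_of_nonneg_left (by linarith) hnd (by linarith)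
  have hq2 : q ≤ 2 * r^2 / n := by
    rw [hrd, hqe, div_le_div_iff₀ hnd hn0]; nlinarith
  have hq0 : 0 < q := lt_of_lt_of_le (by positivity) hq1
  have hqle : q ≤ 1 := by
    rw [hqe, div_le_one hnd]; linarith
  have hb0 : 0 < b := by rw [hb]; positivity
  set τ := ν^9 * r^2 / n with hτ
  have hτ0 : 0 < τ := by positivity
  have hs4 : s^4 ≤ ν^8 := by
    calc s^4 ≤ (ν^2)^4 := by gcongr
      _ = _ := by ring
  have hbτ : b ≤ τ := by
    rw [hb, hτ]
    apply div_le_div_of_nonneg_right _ hn0.le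
    calc 10000 * v * s^3 * r ≤ 10000 * (s * r) * s^3 * r := by gcongr
      _ = 10000 * s^4 * r^2 := by ring
      _ ≤ 10000 * ν^8 * r^2 := by gcongr
      _ ≤ ν^9 * r^2 := by
          apply mul_le_mul_of_nonneg_right _ (sq_nonneg r)
          exact big 8 9 (by norm_num)
  have hv2' : (v:ℝ)^2 ≤ ν^6 := by
    calc (v:ℝ)^2 ≤ (ν^3)^2 := by gcongr
      _ = _ := by ring
  have hvn : 10000 * (v:ℝ)^2 ≤ n := by
    rw [hn]; have := big 6 40 (by norm_num); linarith
  set E := v^2 with hE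
  have hEn : 10000 * E ≤ n := by
    have : ((10000 * E : ℕ) : ℝ) ≤ n := by push_cast [hE]; exact hvn
    exact_mod_cast this
  have hdnN : 10000 * d ≤ n := by exact_mod_cast hdn
  have hE4 : 4 ≤ E := by rw [hE]; nlinarith
  have main := bootstrap (d := d) (bet b τ E) hq hq0 hqle hb0 hτ0.le (bet_pos hb0 hτ0 E) (by simp [bet])
    (bet_succ_le hb0 hbτ E) (bet_le_succ hb0 hbτ E) (3 * E) ?_ ?_ H hH (by omega)
  · have : bet b τ E H.card = b ^ H.card := by
      unfold bet; rw [min_eq_left hL, Nat.sub_eq_zero_of_le hL]; simp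
    rwa [this] at main
  · intro H hH hlo hhi
    refine (crude hd0 (3 * E + 2) (by omega) hq0.le (by rw [hrd] at hq2; exact hq2) H hH hhi).trans ?_
    apply mul_le_mul_of_nonneg_left _ (Nat.cast_nonneg _)
    set m := H.card with hm
    unfold bet
    rw [min_eq_right (by omega)]
    have hbr : r / n ≤ b := by
      rw [hb]
      apply div_le_div_of_nonneg_right _ hn0.le
      have : 1 ≤ s^3 := one_le_pow₀ hs2
      have : 1 * 1 * 1 * r ≤ 10000 * v * s^3 * r := by gcongr <;> linarith
      linarith
    have e1 : (4 * d / n : ℝ)^m = (r/n)^E * ((4 * r)^E * (4 * d/n : ℝ)^(m-E)) := by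
      have : (4 * d / n : ℝ)^m = (4 * d/n : ℝ)^E * (4 * d/n : ℝ)^(m-E) := by
        rw [← pow_add]; congr 1; omega
      rw [this, ← mul_assoc, ← mul_pow]
      congr 2
      rw [← hrd]; ring
    have e2 : τ^(m-E) = (ν^9/4)^(m-E) * (4 * d / n : ℝ)^(m-E) := by
      rw [← mul_pow]; congr 1; rw [hτ, hrd]; ring
    rw [e1, e2]
    apply mul_le_mul (pow_le_pow_left₀ (by positivity) hbr E) _ (by positivity) (by positivity)
    apply mul_le_mul_of_nonneg_right _ (by positivity)
    have hν9 : 1 ≤ ν^9/4 := by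
      have := big 0 9 (by norm_num)
      simp at this; linarith
    calc (4 * r)^E ≤ ((ν^9/4)^2)^E := by
          apply pow_le_pow_left₀ (by positivity)
          have h1 : (ν^9/4)^2 = ν^18/16 := by ring
          rw [h1]
          have := big 10 18 (by norm_num)
          have := pow_pos hν0 10
          linarith
      _ = (ν^9/4)^(2*E) := by rw [pow_mul]
      _ ≤ _ := pow_le_pow_right₀ hν9 (by omega)
  · intro H hH hne hc
    have hw1 : (vertsOf H).card ≤ 6 * E := by
      have := card_verts_le H; omega
    have hw : ((vertsOf H).card : ℝ) ≤ 6 * (v:ℝ)^2 := by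
      have : ((vertsOf H).card : ℝ) ≤ ((6 * E : ℕ) : ℝ) := by exact_mod_cast hw1
      rw [hE] at this; push_cast at this; exact this
    have hN : (((vertsOf H)ᶜ).card : ℝ) = n - (vertsOf H).card := by
      rw [Finset.card_compl, Fintype.card_fin, Nat.cast_sub]
      have := Finset.card_le_univ (vertsOf H)
      simpa using this
    obtain ⟨h1, h2, h3⟩ := num_contr (θ := 6 * (v:ℝ)^2 * τ + q + (3 * (v:ℝ)^2 + 2) * (1 + q / b)) hν hn hr1 hrν hs2 hsν hv2R hvs hvν hq1 hq2 hb hτ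
      (Nat.cast_nonneg _) hw rfl hN rfl
    refine ⟨_, h1, ?_, _, rfl, h2, h3⟩
    have := mul_le_mul_of_nonneg_right hw hτ0.le
    push_cast [hE]
    linarith
end GMP

namespace GMP
open GM

lemma joint {n d : ℕ} {q b : ℝ} (hq0 : 0 ≤ q) (hq1 : q ≤ 1) (hb : 0 ≤ b) (M : ℕ) (Z : ℝ)
    (hyp : ∀ H : Finset (Sym2 (Fin n)), SimpleE H → H.card ≤ M → |mu n d q H| ≤ Z * b^H.card)
    (R R' : Finset (Sym2 (Fin n))) (hR : SimpleE R) (hR' : SimpleE R') (hc : (R ∪ R').card ≤ M) :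
    |ex n d (fun G => fH q G R * fH q G R')| ≤
      Z * (b^((R \ R').card + (R' \ R).card) * (q + b)^(R ∩ R').card) := by
  have hRs : ∀ G : Graph n, fH q G R = fH q G (R \ R') * fH q G (R ∩ R') := by
    intro G; unfold fH
    rw [← Finset.prod_union (Finset.disjoint_sdiff_inter R R'), Finset.sdiff_union_inter]
  have hRs' : ∀ G : Graph n, fH q G R' = fH q G (R' \ R) * fH q G (R ∩ R') := by
    intro G; unfold fH
    rw [Finset.inter_comm, ← Finset.prod_union (Finset.disjoint_sdiff_inter R' R), Finset.sdiff_union_inter]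
  have hdisj : Disjoint (R \ R') (R' \ R) := by
    rw [Finset.disjoint_left]; intro e h1 h2
    simp at h1 h2; tauto
  have hI : ∀ G : Graph n, fH q G (R ∩ R') * fH q G (R ∩ R') =
      ∑ S ∈ (R ∩ R').powerset, (-(1-q))^S.card * q^((R ∩ R') \ S).card * fH q G S := by
    intro G
    unfold fH
    rw [← Finset.prod_mul_distrib]
    have : ∀ e ∈ R ∩ R', fe q G e * fe q G e = (-(1-q)) * fe q G e + q := by
      intro e _; rw [fe_sq]; ring
    rw [Finset.prod_congr rfl this, Finset.prod_add]
    apply Finset.sum_congr rfl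
    intro S _
    rw [Finset.prod_mul_distrib, Finset.prod_const, Finset.prod_const]; ring
  have hex : ex n d (fun G => fH q G R * fH q G R') =
      ∑ S ∈ (R ∩ R').powerset, (-(1-q))^S.card * q^((R ∩ R') \ S).card * mu n d q (((R \ R') ∪ (R' \ R)) ∪ S) := by
    unfold mu ex
    simp_rw [Finset.mul_sum]
    rw [Finset.sum_comm]
    apply Finset.sum_congr rfl
    intro G _
    have : fH q G R * fH q G R' = fH q G (R \ R') * fH q G (R' \ R) * (fH q G (R ∩ R') * fH q G (R ∩ R')) := by
      rw [hRs, hRs']; ring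
    rw [this, hI, Finset.mul_sum]
    apply Finset.sum_congr rfl
    intro S hS
    rw [Finset.mem_powerset] at hS
    have hd2 : Disjoint ((R \ R') ∪ (R' \ R)) S := by
      rw [Finset.disjoint_left]; intro e h1 h2
      have := hS h2
      simp at h1 this; tauto
    have : fH q G (((R \ R') ∪ (R' \ R)) ∪ S) = fH q G (R \ R') * fH q G (R' \ R) * fH q G S := by
      unfold fH; rw [Finset.prod_union hd2, Finset.prod_union hdisj]
    rw [this]; ring
  rw [hex]
  refine (Finset.abs_sum_le_sum_abs _ _).trans ?_
  calc _ ≤ ∑ S ∈ (R ∩ R').powerset, Z * (b^((R \ R').card + (R' \ R).card) * ((∏ e ∈ S, b) * ∏ e ∈ (R ∩ R') \ S, q)) := by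
        apply Finset.sum_le_sum
        intro S hS
        rw [Finset.mem_powerset] at hS
        have hd2 : Disjoint ((R \ R') ∪ (R' \ R)) S := by
          rw [Finset.disjoint_left]; intro e h1 h2
          have := hS h2
          simp at h1 this; tauto
        have hsub : ((R \ R') ∪ (R' \ R)) ∪ S ⊆ R ∪ R' := by
          intro e he
          simp only [Finset.mem_union, Finset.mem_sdiff] at he ⊢
          rcases he with he | he
          · tauto
          · have := hS he; simp at this; tauto
        have h1 := hyp _ (fun e he => by
          have := hsub he
          rw [Finset.mem_union] at this
          exact this.elim (hR e) (hR' e)) ((Finset.card_le_card hsub).trans hc)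
        rw [Finset.card_union_of_disjoint hd2, Finset.card_union_of_disjoint hdisj] at h1
        rw [abs_mul, abs_mul, abs_pow, abs_pow, abs_neg, abs_of_nonneg hq0, abs_of_nonneg (by linarith : 0 ≤ 1 - q),
          Finset.prod_const, Finset.prod_const]
        have h2 : (1-q)^S.card ≤ 1 := pow_le_one₀ (by linarith) (by linarith)
        calc _ ≤ 1 * q^((R ∩ R') \ S).card * (Z * b^((R \ R').card + (R' \ R).card + S.card)) := by
              apply mul_le_mul _ h1 (abs_nonneg _) (by positivity)
              exact mul_le_mul_of_nonneg_right h2 (by positivity)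
          _ = _ := by rw [pow_add]; ring
    _ = _ := by
        rw [← Finset.mul_sum, ← Finset.mul_sum, ← Finset.prod_add, Finset.prod_const, add_comm b q]

/-- connectivity of an edge set -/
def Conn {n : ℕ} (R : Finset (Sym2 (Fin n))) : Prop :=
  ∀ u ∈ vertsOf R, ∀ w ∈ vertsOf R, (SimpleGraph.fromEdgeSet (R : Set (Sym2 (Fin n)))).Reachable u w

lemma tree_count {n : ℕ} {R : Finset (Sym2 (Fin n))} (hc : Conn R) {S : Finset (Fin n)} {s0 : Fin n}
    (hs0 : s0 ∈ S) (hs0R : s0 ∈ vertsOf R) :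
    (vertsOf R \ S).card ≤ (R.filter (fun e => ∃ v ∈ e, v ∉ S)).card := by
  set Γ := SimpleGraph.fromEdgeSet (R : Set (Sym2 (Fin n))) with hΓ
  have hnext : ∀ u ∈ vertsOf R \ S, ∃ u', Γ.Adj u u' ∧ Γ.dist u' s0 < Γ.dist u s0 := by
    intro u hu
    rw [Finset.mem_sdiff] at hu
    have hr : Γ.Reachable u s0 := hc u hu.1 s0 hs0R
    obtain ⟨p, hp⟩ := hr.exists_walk_length_eq_dist
    cases p with
    | nil => exact absurd hs0 hu.2
    | cons h p =>
      refine ⟨_, h, ?_⟩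
      have := SimpleGraph.dist_le p
      simp only [SimpleGraph.Walk.length_cons] at hp
      omega
  choose! f hf1 hf2 using hnext
  apply Finset.card_le_card_of_injOn (fun u => s(u, f u))
  · intro u hu
    have h1 := hf1 u hu
    rw [hΓ, SimpleGraph.fromEdgeSet_adj] at h1
    simp only [Finset.coe_filter, Set.mem_setOf_eq]
    have hu' : u ∈ vertsOf R \ S := hu
    rw [Finset.mem_sdiff] at hu'
    exact ⟨by simpa using h1.1, u, by simp, hu'.2⟩
  · intro u hu w hw h
    have h1 := hf2 u hu
    have h2 := hf2 w hw
    simp only [Sym2.eq, Sym2.rel_iff', Prod.mk.injEq, Prod.swap_prod_mk] at h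
    rcases h with h | h
    · exact h.1
    · rw [h.2] at h1; rw [← h.1] at h2; omega

lemma inter_count {n : ℕ} {R R' : Finset (Sym2 (Fin n))} (hc : Conn R)
    (hne : (vertsOf R ∩ vertsOf R').Nonempty) :
    (R ∩ R').card + (vertsOf R).card ≤ R.card + (vertsOf R ∩ vertsOf R').card := by
  obtain ⟨s0, hs0⟩ := hne
  have h1 := tree_count hc hs0 (Finset.mem_inter.1 hs0).1
  have h2 : (R ∩ R').card ≤ (R.filter (fun e => ¬ ∃ v ∈ e, v ∉ vertsOf R ∩ vertsOf R')).card := by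
    apply Finset.card_le_card
    intro e he
    rw [Finset.mem_inter] at he
    rw [Finset.mem_filter]
    refine ⟨he.1, ?_⟩
    push Not
    intro v hv
    simp only [vertsOf, Finset.mem_inter, Finset.mem_filter, Finset.mem_univ, true_and]
    exact ⟨⟨e, he.1, hv⟩, ⟨e, he.2, hv⟩⟩
  have h3 := Finset.card_filter_add_card_filter_not (s := R) (fun e => ∃ v ∈ e, v ∉ vertsOf R ∩ vertsOf R')
  have h4 : (vertsOf R \ (vertsOf R ∩ vertsOf R')).card + (vertsOf R ∩ vertsOf R').card = (vertsOf R).card := by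
    rw [Finset.card_sdiff_add_card_eq_card Finset.inter_subset_left]
  omega

lemma edge_lower {n : ℕ} {R : Finset (Sym2 (Fin n))} (hR : SimpleE R) (hc : Conn R) :
    (vertsOf R).card ≤ R.card + 1 := by
  by_cases h : (vertsOf R).Nonempty
  · obtain ⟨s0, hs0⟩ := h
    have h1 := tree_count hc (S := {s0}) (by simp) hs0
    have h2 := Finset.card_le_card (Finset.filter_subset (fun e => ∃ v ∈ e, v ∉ ({s0} : Finset (Fin n))) R)
    have h3 : (vertsOf R \ {s0}).card + 1 = (vertsOf R).card := by
      rw [Finset.sdiff_singleton_eq_erase, Finset.card_erase_add_one hs0]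
    omega
  · rw [Finset.not_nonempty_iff_eq_empty] at h
    simp [h]

/-- weight of a graph -/
def uw {n : ℕ} (b ρ : ℝ) (v : ℕ) (R : Finset (Sym2 (Fin n))) : ℝ := b^(v-1) * ρ^(R.card - (v-1))

lemma weight {n : ℕ} {b Q ρ : ℝ} (hb : 0 < b) (hρ : ρ^2 = Q) (hbρ : b ≤ ρ) {v : ℕ} (hv : 2 ≤ v)
    {R R' : Finset (Sym2 (Fin n))} (hR : SimpleE R) (hR' : SimpleE R') (hc : Conn R) (hc' : Conn R')
    (hV : (vertsOf R).card = v) (hV' : (vertsOf R').card = v) :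
    b^((R \ R').card + (R' \ R).card) * Q^(R ∩ R').card ≤
      (Q / b^2)^((vertsOf R ∩ vertsOf R').card - 1) * (uw b ρ v R * uw b ρ v R') := by
  have hρ0 : 0 < ρ := lt_of_lt_of_le hb hbρ
  have hγ : Q / b^2 = (ρ / b)^2 := by rw [← hρ]; ring
  have hg1 : 1 ≤ ρ / b := by rw [le_div_iff₀ hb]; linarith
  set g := ρ / b with hg
  have hρg : ρ = b * g := by rw [hg]; field_simp
  have e1 := edge_lower hR hc
  have e2 := edge_lower hR' hc'
  have c1 : (R \ R').card + (R ∩ R').card = R.card := Finset.card_sdiff_add_card_inter R R'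
  have c2 : (R' \ R).card + (R ∩ R').card = R'.card := by
    rw [Finset.inter_comm]; exact Finset.card_sdiff_add_card_inter R' R
  have key1 : (R ∩ R').card ≤ ((vertsOf R ∩ vertsOf R').card - 1) + (R.card - (v-1)) ∧
      (R ∩ R').card ≤ ((vertsOf R ∩ vertsOf R').card - 1) + (R'.card - (v-1)) := by
    by_cases h : (vertsOf R ∩ vertsOf R').Nonempty
    · have h1 := inter_count hc h
      have h2 := inter_count hc' (by rwa [Finset.inter_comm] at h)
      rw [Finset.inter_comm R' R, Finset.inter_comm (vertsOf R')] at h2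
      have := Finset.card_pos.2 h
      omega
    · have : R ∩ R' = ∅ := by
        rw [Finset.eq_empty_iff_forall_notMem]
        intro e he
        rw [Finset.mem_inter] at he
        apply h
        induction e using Sym2.ind with
        | h x y => exact ⟨x, Finset.mem_inter.2 ⟨(mem_verts he.1).1, (mem_verts he.2).1⟩⟩
      rw [this]; simp
  set i := (R ∩ R').card
  set j := (vertsOf R ∩ vertsOf R').card - 1
  set x := R.card - (v-1) with hx
  set x' := R'.card - (v-1) with hx'
  have hR1 : R.card = (v-1) + x := by omega
  have hR2 : R'.card = (v-1) + x' := by omega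
  have lhs : b^((R \ R').card + (R' \ R).card) * Q^i = b^(R.card + R'.card) * g^(2*i) := by
    rw [← hρ, hρg, ← c1, ← c2]
    ring
  rw [lhs, hγ, hR1, hR2]
  unfold uw
  rw [← hx, ← hx', hρg]
  have rhs : (g^2)^j * (b^(v-1) * (b*g)^x * (b^(v-1) * (b*g)^x')) = b^(v - 1 + x + (v - 1 + x')) * g^(2*j + x + x') := by
    ring
  rw [rhs]
  apply mul_le_mul_of_nonneg_left _ (by positivity)
  exact pow_le_pow_right₀ hg1 (by omega)
end GMP

namespace GMP
open GM

def Fam (n v : ℕ) : Finset (Finset (Sym2 (Fin n))) :=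
  Finset.univ.filter (fun R => SimpleE R ∧ Conn R ∧ (vertsOf R).card = v)

lemma mem_Fam {n v : ℕ} {R : Finset (Sym2 (Fin n))} :
    R ∈ Fam n v ↔ SimpleE R ∧ Conn R ∧ (vertsOf R).card = v := by simp [Fam]

lemma sub_sym2 {n : ℕ} (R : Finset (Sym2 (Fin n))) : R ⊆ (vertsOf R).sym2 := by
  intro e he
  rw [Finset.mem_sym2_iff]
  intro a ha
  simp only [vertsOf, Finset.mem_filter, Finset.mem_univ, true_and]
  exact ⟨e, he, ha⟩

lemma sumA {n : ℕ} {b ρ : ℝ} (hb : 0 ≤ b) (hρ : 0 ≤ ρ) {v : ℕ} (W : Finset (Fin n)) :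
    ∑ R ∈ (Fam n v).filter (fun R => vertsOf R = W), uw b ρ v R ≤
      b^(v-1) * ((W.sym2.card.choose (v-1) : ℕ) * (1 + ρ)^W.sym2.card) := by
  unfold uw
  rw [← Finset.mul_sum]
  apply mul_le_mul_of_nonneg_left _ (by positivity)
  set P := W.sym2
  set F := (Fam n v).filter (fun R => vertsOf R = W) with hF
  have hsub : ∀ R ∈ F, R ⊆ P := by
    intro R hR
    rw [hF, Finset.mem_filter] at hR
    have := sub_sym2 R
    rwa [hR.2] at this
  have hex : ∀ R ∈ F, ∃ R0 ⊆ R, R0.card = v - 1 := by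
    intro R hR
    rw [hF, Finset.mem_filter, mem_Fam] at hR
    apply Finset.exists_subset_card_eq
    have := edge_lower hR.1.1 hR.1.2.1
    omega
  choose! f hf1 hf2 using hex
  have inj : Set.InjOn (fun R => (f R, R \ f R)) (F : Set (Finset (Sym2 (Fin n)))) := by
    intro R hR R' hR' h
    simp only [Prod.mk.injEq] at h
    rw [← Finset.union_sdiff_of_subset (hf1 R hR), ← Finset.union_sdiff_of_subset (hf1 R' hR'), h.1, ← h.2, h.1]
  calc ∑ R ∈ F, ρ^(R.card - (v-1)) = ∑ R ∈ F, ρ^(R \ f R).card := by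
        apply Finset.sum_congr rfl
        intro R hR
        rw [Finset.card_sdiff_of_subset (hf1 R hR), hf2 R hR]
    _ = ∑ y ∈ F.image (fun R => (f R, R \ f R)), ρ^y.2.card := by
        rw [Finset.sum_image inj]
    _ ≤ ∑ y ∈ (P.powersetCard (v-1)) ×ˢ P.powerset, ρ^y.2.card := by
        apply Finset.sum_le_sum_of_subset_of_nonneg
        · intro y hy
          rw [Finset.mem_image] at hy
          obtain ⟨R, hR, rfl⟩ := hy
          rw [Finset.mem_product, Finset.mem_powersetCard, Finset.mem_powerset]
          exact ⟨⟨(hf1 R hR).trans (hsub R hR), hf2 R hR⟩, Finset.sdiff_subset.trans (hsub R hR)⟩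
        · intros; positivity
    _ = _ := by
        rw [Finset.sum_product]
        simp only [Finset.sum_const, Finset.card_powersetCard, nsmul_eq_mul]
        congr 1
        have := Finset.prod_add (fun _ => ρ) (fun _ => (1:ℝ)) P
        simp only [Finset.prod_const, one_pow, mul_one] at this
        rw [← this, add_comm]

lemma sumA' {n : ℕ} {b ρ : ℝ} (hb : 0 ≤ b) (hρ : 0 ≤ ρ) {v : ℕ} (hv : 2 ≤ v) (hvρ : (v:ℝ)^2 * ρ ≤ 1/2)
    (W : Finset (Fin n)) (hW : W.card = v) :
    ∑ R ∈ (Fam n v).filter (fun R => vertsOf R = W), uw b ρ v R ≤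
      2 * b^(v-1) * (((v:ℝ)^2)^(v-1) / (v-1).factorial) := by
  refine (sumA hb hρ W).trans ?_
  have hc : W.sym2.card ≤ v^2 := by
    rw [Finset.card_sym2, hW, Nat.choose_two_right, Nat.add_sub_cancel]
    have : (v+1) * v ≤ 2 * v^2 := by nlinarith
    omega
  set M := W.sym2.card
  have hcR : (M:ℝ) ≤ (v:ℝ)^2 := by exact_mod_cast hc
  have h1 : ((M.choose (v-1) : ℕ) : ℝ) ≤ ((v:ℝ)^2)^(v-1) / (v-1).factorial := by
    refine (Nat.choose_le_pow_div (v-1) M).trans ?_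
    gcongr
  have h2 : (1 + ρ)^M ≤ 2 := by
    have e1 : 1 + ρ ≤ Real.exp ρ := by linarith [Real.add_one_le_exp ρ]
    calc (1+ρ)^M ≤ (Real.exp ρ)^M := by gcongr
      _ = Real.exp (M * ρ) := by rw [← Real.exp_nat_mul]
      _ ≤ Real.exp (1/2) := by
          apply Real.exp_le_exp.2
          exact (mul_le_mul_of_nonneg_right hcR hρ).trans hvρ
      _ ≤ 2 := by
          have h3 : Real.exp (1/2) * Real.exp (1/2) = Real.exp 1 := by rw [← Real.exp_add]; norm_num
          have := Real.exp_one_lt_d9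
          have := Real.exp_pos (1/2)
          nlinarith
  calc _ ≤ b^(v-1) * ((((v:ℝ)^2)^(v-1) / (v-1).factorial) * 2) := by gcongr
    _ = _ := by ring

lemma sumB {n : ℕ} {γ : ℝ} (hγ : 0 ≤ γ) {v : ℕ} (hv : 2 ≤ v) (hγv : γ * (v:ℝ)^2 ≤ n) (hvn : v^3 ≤ n)
    (W : Finset (Fin n)) (hW : W.card = v) :
    ∑ W' ∈ (Finset.univ : Finset (Fin n)).powersetCard v, γ^((W ∩ W').card - 1) ≤ 2 * (n:ℝ)^v / v.factorial := by
  have hn0 : (0:ℝ) < n := by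
    have : 0 < v^3 := by positivity
    have : 0 < n := by omega
    exact_mod_cast this
  have hv0 : (0:ℝ) < v := by
    have : 0 < v := by omega
    exact_mod_cast this
  have hmap : ∀ W' ∈ (Finset.univ : Finset (Fin n)).powersetCard v, (W ∩ W').card ∈ Finset.range (v+1) := by
    intro W' _
    rw [Finset.mem_range]
    have := Finset.card_le_card (Finset.inter_subset_left (s₁ := W) (s₂ := W'))
    omega
  rw [← Finset.sum_fiberwise_of_maps_to hmap]
  have hfib : ∀ j ∈ Finset.range (v+1), ∑ W' ∈ ((Finset.univ : Finset (Fin n)).powersetCard v).filter (fun W' => (W ∩ W').card = j),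
      γ^((W ∩ W').card - 1) ≤ (v.choose j * n.choose (v-j) : ℝ) * γ^(j-1) := by
    intro j hj
    rw [Finset.mem_range] at hj
    have : ∀ W' ∈ ((Finset.univ : Finset (Fin n)).powersetCard v).filter (fun W' => (W ∩ W').card = j), γ^((W ∩ W').card - 1) = γ^(j-1) := by
      intro W' hW'
      rw [(Finset.mem_filter.1 hW').2]
    rw [Finset.sum_congr rfl this, Finset.sum_const, nsmul_eq_mul]
    apply mul_le_mul_of_nonneg_right _ (by positivity)
    have hcard : (((Finset.univ : Finset (Fin n)).powersetCard v).filter (fun W' => (W ∩ W').card = j)).card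
        ≤ ((W.powersetCard j) ×ˢ ((Finset.univ : Finset (Fin n)).powersetCard (v-j))).card := by
      apply Finset.card_le_card_of_injOn (fun W' => (W ∩ W', W' \ W))
      · intro W' hW'
        have hW2 := Finset.mem_filter.1 (Finset.mem_coe.1 hW')
        rw [Finset.mem_powersetCard] at hW2
        rw [Finset.mem_coe, Finset.mem_product, Finset.mem_powersetCard, Finset.mem_powersetCard]
        refine ⟨⟨Finset.inter_subset_left, hW2.2⟩, Finset.subset_univ _, ?_⟩
        have := Finset.card_sdiff_add_card_inter W' W
        rw [Finset.inter_comm] at this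
        show (W' \ W).card = v - j
        omega
      · intro A _ B _ h
        simp only [Prod.mk.injEq] at h
        have e1 := Finset.sdiff_union_inter A W
        have e2 := Finset.sdiff_union_inter B W
        rw [← e1, ← e2, h.2, Finset.inter_comm A, h.1, Finset.inter_comm B]
    rw [Finset.card_product, Finset.card_powersetCard, Finset.card_powersetCard, hW, Finset.card_univ, Fintype.card_fin] at hcard
    exact_mod_cast hcard
  refine (Finset.sum_le_sum hfib).trans ?_
  have hfac : ∀ j ≤ v, ((n.choose (v-j) : ℕ) : ℝ) ≤ (n:ℝ)^(v-j) * (v:ℝ)^j / v.factorial := by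
    intro j hj
    refine (Nat.choose_le_pow_div (v-j) n).trans ?_
    rw [div_le_div_iff₀ (by positivity) (by positivity), mul_assoc]
    apply mul_le_mul_of_nonneg_left _ (by positivity)
    have h1 : v.factorial ≤ (v-j).factorial * v^j := by
      have := Nat.factorial_mul_descFactorial hj
      rw [← this]
      exact Nat.mul_le_mul_left _ (Nat.descFactorial_le_pow v j)
    have : ((v.factorial : ℕ) : ℝ) ≤ ((v-j).factorial * v^j : ℕ) := by exact_mod_cast h1
    push_cast at this; linarith
  rw [Finset.sum_range_succ']
  have h0 : ((v.choose 0 : ℕ) * (n.choose (v-0) : ℕ) : ℝ) * γ^(0-1) ≤ (n:ℝ)^v / v.factorial := by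
    simp
    simpa using hfac 0 (by omega)
  have hj : ∀ j ∈ Finset.range v, ((v.choose (j+1) : ℕ) * (n.choose (v-(j+1)) : ℕ) : ℝ) * γ^(j+1-1) ≤ (v:ℝ)^2 * (n:ℝ)^(v-1) / v.factorial := by
    intro j hj
    rw [Finset.mem_range] at hj
    have c1 : ((v.choose (j+1) : ℕ) : ℝ) ≤ (v:ℝ)^(j+1) := by exact_mod_cast Nat.choose_le_pow v (j+1)
    calc _ ≤ ((v:ℝ)^(j+1) * ((n:ℝ)^(v-(j+1)) * (v:ℝ)^(j+1) / v.factorial)) * γ^j := by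
          rw [Nat.add_sub_cancel]
          apply mul_le_mul_of_nonneg_right _ (by positivity)
          exact mul_le_mul c1 (hfac _ (by omega)) (by positivity) (by positivity)
      _ = ((γ * (v:ℝ)^2)^j * (n:ℝ)^(v-(j+1))) * (v:ℝ)^2 / v.factorial := by ring
      _ ≤ ((n:ℝ)^j * (n:ℝ)^(v-(j+1))) * (v:ℝ)^2 / v.factorial := by gcongr
      _ = _ := by
          rw [← pow_add]
          have : j + (v - (j+1)) = v - 1 := by omega
          rw [this]; ring
  have hsum := Finset.sum_le_card_nsmul _ _ _ hj
  rw [Finset.card_range, nsmul_eq_mul] at hsum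
  have hlast : (v:ℝ) * ((v:ℝ)^2 * (n:ℝ)^(v-1) / v.factorial) ≤ (n:ℝ)^v / v.factorial := by
    have hvn' : (v:ℝ)^3 ≤ n := by exact_mod_cast hvn
    have : (n:ℝ)^v = n * (n:ℝ)^(v-1) := by
      rw [← pow_succ']; congr 1; omega
    rw [this]
    calc (v:ℝ) * ((v:ℝ)^2 * (n:ℝ)^(v-1) / v.factorial) = (v:ℝ)^3 * (n:ℝ)^(v-1) / v.factorial := by ring
      _ ≤ _ := by gcongr
  have : 2 * (n:ℝ)^v / v.factorial = (n:ℝ)^v / v.factorial + (n:ℝ)^v / v.factorial := by ring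
  rw [this]
  exact add_le_add (hsum.trans hlast) h0

lemma uw_nonneg {n : ℕ} {b ρ : ℝ} (hb : 0 ≤ b) (hρ : 0 ≤ ρ) {v : ℕ} (R : Finset (Sym2 (Fin n))) : 0 ≤ uw b ρ v R := by
  unfold uw; positivity

lemma double_sum {n : ℕ} {b ρ γ : ℝ} (hb : 0 ≤ b) (hρ : 0 ≤ ρ) (hγ : 0 ≤ γ) {v : ℕ} (hv : 2 ≤ v)
    (hvρ : (v:ℝ)^2 * ρ ≤ 1/2) (hγv : γ * (v:ℝ)^2 ≤ n) (hvn : v^3 ≤ n) :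
    ∑ R ∈ Fam n v, ∑ R' ∈ Fam n v, γ^((vertsOf R ∩ vertsOf R').card - 1) * (uw b ρ v R * uw b ρ v R') ≤
      (2 * b^(v-1) * (((v:ℝ)^2)^(v-1) / (v-1).factorial))^2 * (2 * (n:ℝ)^v / v.factorial) * ((n:ℝ)^v / v.factorial) := by
  set A := 2 * b^(v-1) * (((v:ℝ)^2)^(v-1) / (v-1).factorial) with hA
  have hA0 : 0 ≤ A := by positivity
  set B := 2 * (n:ℝ)^v / v.factorial with hB
  have hB0 : 0 ≤ B := by positivity
  have hmap : ∀ R ∈ Fam n v, vertsOf R ∈ (Finset.univ : Finset (Fin n)).powersetCard v := by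
    intro R hR
    rw [Finset.mem_powersetCard]
    exact ⟨Finset.subset_univ _, (mem_Fam.1 hR).2.2⟩
  have inner : ∀ R ∈ Fam n v, ∑ R' ∈ Fam n v, γ^((vertsOf R ∩ vertsOf R').card - 1) * (uw b ρ v R * uw b ρ v R')
      ≤ uw b ρ v R * (A * B) := by
    intro R hR
    rw [← Finset.sum_fiberwise_of_maps_to hmap]
    have h1 : ∀ W' ∈ (Finset.univ : Finset (Fin n)).powersetCard v,
        ∑ R' ∈ (Fam n v).filter (fun R' => vertsOf R' = W'), γ^((vertsOf R ∩ vertsOf R').card - 1) * (uw b ρ v R * uw b ρ v R')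
        ≤ (uw b ρ v R * A) * γ^((vertsOf R ∩ W').card - 1) := by
      intro W' hW'
      rw [Finset.mem_powersetCard] at hW'
      have h2 : ∀ R' ∈ (Fam n v).filter (fun R' => vertsOf R' = W'), γ^((vertsOf R ∩ vertsOf R').card - 1) * (uw b ρ v R * uw b ρ v R')
        = (γ^((vertsOf R ∩ W').card - 1) * uw b ρ v R) * uw b ρ v R' := by
        intro R' hR'
        rw [(Finset.mem_filter.1 hR').2]; ring
      rw [Finset.sum_congr rfl h2, ← Finset.mul_sum]
      have h3 := mul_le_mul_of_nonneg_left (sumA' hb hρ hv hvρ W' hW'.2)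
        (mul_nonneg (pow_nonneg hγ ((vertsOf R ∩ W').card - 1)) (uw_nonneg hb hρ (v := v) R))
      refine h3.trans (le_of_eq ?_)
      rw [hA]; ring
    refine (Finset.sum_le_sum h1).trans ?_
    rw [← Finset.mul_sum]
    refine (mul_le_mul_of_nonneg_left (sumB hγ hv hγv hvn _ (mem_Fam.1 hR).2.2)
      (mul_nonneg (uw_nonneg hb hρ _) hA0)).trans (le_of_eq ?_)
    ring
  refine (Finset.sum_le_sum inner).trans ?_
  rw [← Finset.sum_mul]
  have outer : ∑ R ∈ Fam n v, uw b ρ v R ≤ (n:ℝ)^v / v.factorial * A := by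
    rw [← Finset.sum_fiberwise_of_maps_to hmap]
    refine (Finset.sum_le_card_nsmul _ _ A ?_).trans ?_
    · intro W hW
      rw [Finset.mem_powersetCard] at hW
      exact sumA' hb hρ hv hvρ W hW.2
    · rw [nsmul_eq_mul, Finset.card_powersetCard, Finset.card_univ, Fintype.card_fin]
      exact mul_le_mul_of_nonneg_right (Nat.choose_le_pow_div v n) hA0
  refine (mul_le_mul_of_nonneg_right outer (mul_nonneg hA0 hB0)).trans (le_of_eq ?_)
  ring
end GMP

namespace GMP
open GM

lemma simple_card {n : ℕ} {R : Finset (Sym2 (Fin n))} (hR : SimpleE R) :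
    R.card + R.card ≤ (vertsOf R).card ^ 2 := by
  have h1 : R ⊆ (vertsOf R).sym2.filter (fun e => ¬ e.IsDiag) := by
    intro e he
    exact Finset.mem_filter.2 ⟨sub_sym2 R he, hR e he⟩
  have h2 : ((vertsOf R).sym2.filter (fun e => ¬ e.IsDiag)) ⊆ ((vertsOf R).offDiag.image (Function.uncurry Sym2.mk)) := by
    intro e he
    rw [Finset.mem_filter] at he
    induction e using Sym2.ind with
    | _ a b =>
      rw [Finset.mem_image]
      refine ⟨(a, b), ?_, rfl⟩
      rw [Finset.mem_offDiag]
      have := he.1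
      rw [Finset.mk_mem_sym2_iff] at this
      exact ⟨this.1, this.2, by simpa using he.2⟩
  have h3 := Finset.card_le_card (h1.trans h2)
  rw [Sym2.card_image_offDiag, Nat.choose_two_right] at h3
  have h4 := Nat.div_mul_le_self ((vertsOf R).card * ((vertsOf R).card - 1)) 2
  have h5 : (vertsOf R).card * ((vertsOf R).card - 1) ≤ (vertsOf R).card ^ 2 := by
    rw [pow_two]; exact Nat.mul_le_mul_left _ (Nat.sub_le _ _)
  omega

def Xv (n : ℕ) (q κ : ℝ) (v : ℕ) (G : Graph n) : ℝ :=
  ∑ R ∈ Fam n v, (v * κ^v) * fH q G R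

lemma numerics (k b N : ℝ) (hN : 0 < N) (w : ℕ) :
    (((w+1 : ℕ):ℝ) * (k/N)^(w+1))^2 * ((2 * b^w * ((((w+1:ℕ):ℝ)^2)^w / w.factorial))^2 * (2 * N^(w+1) / (w+1).factorial) * (N^(w+1) / (w+1).factorial))
     ≤ 8 * k^2 * 81^(w+1) * (k*b)^(2*w) := by
  have hf : (0:ℝ) < w.factorial := by positivity
  have hexp : (((w+1:ℕ):ℝ)^(w+1) / (w+1).factorial) ≤ 3^(w+1) := by
    refine (Real.pow_div_factorial_le_exp ((w+1:ℕ):ℝ) (by positivity) (w+1)).trans ?_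
    rw [← Real.exp_one_pow]
    exact pow_le_pow_left₀ (Real.exp_pos 1).le (Real.exp_one_lt_three.le) _
  have hexp4 : (((w+1:ℕ):ℝ)^(w+1) / (w+1).factorial)^4 ≤ 81^(w+1) := by
    refine (pow_le_pow_left₀ (by positivity) hexp 4).trans (le_of_eq ?_)
    rw [← pow_mul, mul_comm, pow_mul]; norm_num
  have : (((w+1 : ℕ):ℝ) * (k/N)^(w+1))^2 * ((2 * b^w * ((((w+1:ℕ):ℝ)^2)^w / w.factorial))^2 * (2 * N^(w+1) / (w+1).factorial) * (N^(w+1) / (w+1).factorial))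
     = 8 * k^2 * (k*b)^(2*w) * (((w+1:ℕ):ℝ)^(w+1) / (w+1).factorial)^4 := by
    rw [Nat.factorial_succ, Nat.cast_mul]
    have hw : ((w+1:ℕ):ℝ) ≠ 0 := by positivity
    generalize ((w+1:ℕ):ℝ) = V at *
    rw [div_pow]
    field_simp
    ring
  rw [this]
  have h0 : 0 ≤ 8 * k^2 * (k*b)^(2*w) := by
    have : (k*b)^(2*w) = ((k*b)^w)^2 := by ring
    rw [this]; positivity
  refine (mul_le_mul_of_nonneg_left hexp4 h0).trans (le_of_eq ?_)
  ring

lemma second_moment {n d : ℕ} {q b k Z : ℝ} {v : ℕ} (hZ : 0 ≤ Z) (hq0 : 0 ≤ q) (hq1 : q ≤ 1) (hb : 0 < b) (hb1 : b ≤ 1)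
    (hv : 2 ≤ v) (hvn : v^3 ≤ n)
    (hyp : ∀ H : Finset (Sym2 (Fin n)), SimpleE H → H.card ≤ v^2 → |mu n d q H| ≤ Z * b^H.card)
    (hQ : (v:ℝ)^4 * (q+b) ≤ 1/4) (hγ : (q+b)/b^2 * (v:ℝ)^2 ≤ n) :
    ex n d (fun G => (Xv n q (k/n) v G)^2) ≤ Z * (8 * k^2 * 81^v * (k*b)^(2*(v-1))) := by
  set ρ := Real.sqrt (q+b) with hρ
  have hQ0 : 0 ≤ q + b := by positivity
  have hρ2 : ρ^2 = q + b := Real.sq_sqrt hQ0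
  have hρ0 : 0 ≤ ρ := Real.sqrt_nonneg _
  have hbρ : b ≤ ρ := Real.le_sqrt_of_sq_le (by nlinarith)
  have hvρ : (v:ℝ)^2 * ρ ≤ 1/2 := by
    apply abs_le_of_sq_le_sq' _ (by norm_num) |>.2
    rw [mul_pow, hρ2]; calc _ = (v:ℝ)^4 * (q+b) := by ring
      _ ≤ _ := by linarith
  have hn0 : (0:ℝ) < n := by
    have : 0 < v^3 := by positivity
    exact_mod_cast this.trans_le hvn
  have hds := double_sum (n := n) hb.le hρ0 (γ := (q+b)/b^2) (by positivity) hv hvρ hγ hvn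
  have e1 : ex n d (fun G => (Xv n q (k/n) v G)^2) =
      ∑ R ∈ Fam n v, ∑ R' ∈ Fam n v, (v * (k/n)^v)^2 * ex n d (fun G => fH q G R * fH q G R') := by
    rw [ex_congr (ψ := fun G => ∑ R ∈ Fam n v, ∑ R' ∈ Fam n v, (v * (k/n)^v)^2 * (fH q G R * fH q G R'))]
    · rw [ex_sum]
      refine Finset.sum_congr rfl fun R _ => ?_
      rw [ex_sum]
      refine Finset.sum_congr rfl fun R' _ => ?_
      rw [ex_mul]
    · intro G _
      unfold Xv
      rw [pow_two, Finset.sum_mul_sum]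
      refine Finset.sum_congr rfl fun R _ => Finset.sum_congr rfl fun R' _ => ?_
      ring
  rw [e1]
  have e2 : ∑ R ∈ Fam n v, ∑ R' ∈ Fam n v, (v * (k/n)^v)^2 * ex n d (fun G => fH q G R * fH q G R')
     ≤ ∑ R ∈ Fam n v, ∑ R' ∈ Fam n v, ((v * (k/n)^v)^2 * Z) * (((q+b)/b^2)^((vertsOf R ∩ vertsOf R').card - 1) * (uw b ρ v R * uw b ρ v R')) := by
    refine Finset.sum_le_sum fun R hR => Finset.sum_le_sum fun R' hR' => ?_
    rw [mem_Fam] at hR hR'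
    rw [mul_assoc]
    apply mul_le_mul_of_nonneg_left _ (sq_nonneg _)
    have hcard : (R ∪ R').card ≤ v^2 := by
      have h1 := simple_card hR.1
      have h2 := simple_card hR'.1
      rw [hR.2.2] at h1; rw [hR'.2.2] at h2
      have := Finset.card_union_le R R'
      omega
    refine (le_abs_self _).trans ((joint hq0 hq1 hb.le (v^2) Z hyp R R' hR.1 hR'.1 hcard).trans ?_)
    exact mul_le_mul_of_nonneg_left (weight hb hρ2 hbρ hv hR.1 hR'.1 hR.2.1 hR'.2.1 hR.2.2 hR'.2.2) hZ
  refine e2.trans ?_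
  simp_rw [← Finset.mul_sum]
  refine (mul_le_mul_of_nonneg_left hds (mul_nonneg (sq_nonneg _) hZ)).trans ?_
  obtain ⟨w, rfl⟩ : ∃ w, v = w + 1 := ⟨v-1, by omega⟩
  have := mul_le_mul_of_nonneg_left (numerics k b n hn0 w) hZ
  simp only [Nat.add_sub_cancel]
  refine le_trans (le_of_eq ?_) this
  ring
end GMP

namespace GMP
open GM

lemma geo_le (D : ℕ) : ∑ v ∈ Finset.Icc 2 D, (1/2:ℝ)^v ≤ 2 := by
  refine le_trans ?_ (sum_geometric_two_le (D+1))
  apply Finset.sum_le_sum_of_subset_of_nonneg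
  · intro v hv; simp at hv ⊢; omega
  · intros; positivity

lemma cs (D : ℕ) (x : ℕ → ℝ) : (∑ v ∈ Finset.Icc 2 D, x v)^2 ≤ 2 * ∑ v ∈ Finset.Icc 2 D, 2^v * (x v)^2 := by
  have h := Finset.sum_sq_le_sum_mul_sum_of_sq_le_mul (Finset.Icc 2 D) (r := x) (f := fun v => (1/2:ℝ)^v) (g := fun v => 2^v * (x v)^2)
    (fun i _ => by positivity) (fun i _ => by positivity) (fun i _ => by
      apply le_of_eq; rw [← mul_assoc, ← mul_pow]; norm_num)
  refine h.trans (mul_le_mul_of_nonneg_right (geo_le D) ?_)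
  apply Finset.sum_nonneg; intros; positivity

lemma sq_le_three (w : ℕ) : ((w+2:ℕ):ℝ)^2 ≤ 4 * 3^w := by
  induction w with
  | zero => norm_num
  | succ w ih =>
    push_cast at *
    rw [pow_succ (3:ℝ) w]
    nlinarith [sq_nonneg (w:ℝ), (Nat.cast_nonneg w : (0:ℝ) ≤ w)]

lemma term_bound {η l : ℝ} {v : ℕ} (hv : 2 ≤ v) (hl : 0 < l) (hη0 : 0 ≤ η) (hη1 : η ≤ 1/100)
    (hη : η ≤ v / (10^6 * l)) : 2^v * (8 * 81^v * η^(2*(v-1))) ≤ (1/2)^v * (1/(4*l^2)) := by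
  obtain ⟨w, rfl⟩ : ∃ w, v = w + 2 := ⟨v-2, by omega⟩
  have e : (2:ℝ)^(w+2) * (8 * 81^(w+2) * η^(2*(w+2-1))) = (8 * 162^2) * η^2 * (162*η^2)^w := by
    rw [show 2*(w+2-1) = 2*w+2 by omega, mul_pow, show (162:ℝ)^w = 2^w*81^w by rw [← mul_pow]; norm_num]
    rw [← pow_mul]; ring
  rw [e]
  have h1 : 162*η^2 ≤ 1/6 := by nlinarith
  have h2 : η^2 ≤ ((w+2:ℕ):ℝ)^2 / (10^12 * l^2) := by
    refine (pow_le_pow_left₀ hη0 hη 2).trans (le_of_eq ?_)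
    rw [div_pow, mul_pow]; norm_num
  calc (8 * 162^2) * η^2 * (162*η^2)^w ≤ (8 * 162^2) * (4 * 3^w / (10^12 * l^2)) * (1/6)^w := by
        have := sq_le_three w
        have h3 : η^2 ≤ 4 * 3^w / (10^12 * l^2) := h2.trans (by gcongr)
        gcongr
    _ = (8*162^2 * 4 * 4 * 4/ 10^12) * ((1/2)^(w+2) * (1/(4*l^2))) := by
        rw [show (1/6:ℝ)^w = (1/2)^w * (1/3)^w by rw [← mul_pow]; norm_num]
        have : (3:ℝ)^w * (1/3)^w = 1 := by rw [← mul_pow]; norm_num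
        calc _ = (8 * 162^2) * (4 / (10^12 * l^2)) * (1/2)^w * ((3:ℝ)^w * (1/3)^w) := by ring
          _ = _ := by rw [this, pow_add]; field_simp; ring
    _ ≤ 1 * ((1/2)^(w+2) * (1/(4*l^2))) := by
        apply mul_le_mul_of_nonneg_right (by norm_num) (by positivity)
    _ = _ := one_mul _

lemma sm_v {n d v : ℕ} {q r s ν k l : ℝ} (hν : 10000 ≤ ν) (hn : (n:ℝ) = ν^40)
    (hr1 : 1 ≤ r) (hrν : r ≤ ν^10) (hrd : r^2 = d) (hs2 : 2 ≤ s) (hsν : s ≤ ν^2) (hv2 : 2 ≤ v)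
    (hvs : (v:ℝ) ≤ s*r) (hvν : (v:ℝ) ≤ ν^3) (hq : q*((n:ℝ)-d) = d)
    (hl : 0 < l) (hvl : (v:ℝ) ≤ s*l) (hk0 : 0 < k) (hk : k ≤ n / (r * s^43 * l)) :
    ex n d (fun G => (Xv n q (k/n) v G)^2) * 2^v ≤ ((regularGraphs n d).card * k^2) * ((1/2)^v * (1/(4*l^2))) := by
  set b := 10000*v*s^3*r/n with hb
  have hν0 : (0:ℝ) < ν := by linarith
  have hn0 : (0:ℝ) < n := by rw [hn]; positivity
  have hv0 : (2:ℝ) ≤ v := by exact_mod_cast hv2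
  have hb0 : 0 < b := by rw [hb]; positivity
  have hd20 : (d:ℝ) ≤ ν^20 := by
    rw [← hrd]; calc r^2 ≤ (ν^10)^2 := by gcongr
      _ = _ := by ring
  have h20 : (2:ℝ) * ν^20 ≤ ν^40 := by
    have : (2:ℝ) ≤ ν^20 := by calc (2:ℝ) ≤ 10000^20 := by norm_num
        _ ≤ _ := by gcongr
    calc (2:ℝ) * ν^20 ≤ ν^20*ν^20 := by gcongr
      _ = _ := by ring
  have hnd : (n:ℝ)/2 ≤ n - d := by rw [hn]; linarith
  have hd0 : (0:ℝ) ≤ d := Nat.cast_nonneg d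
  have hqe : q = d / ((n:ℝ)-d) := by
    rw [eq_div_iff (by linarith)]; exact hq
  have hq0 : 0 ≤ q := by rw [hqe]; apply div_nonneg hd0; linarith
  have hqn : q ≤ 2*d/n := by
    rw [le_div_iff₀ hn0]
    nlinarith
  have hqν : q ≤ 2/ν^20 := by
    refine hqn.trans ?_
    rw [hn, div_le_div_iff₀ (by positivity) (by positivity)]
    calc 2 * (d:ℝ) * ν^20 ≤ 2 * ν^20 * ν^20 := by gcongr
      _ = _ := by ring
  have hbν : b ≤ 1/ν^20 := by
    rw [hb, hn, div_le_div_iff₀ (by positivity) (by positivity)]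
    calc 10000 * (v:ℝ) * s^3 * r * ν^20 ≤ ν * ν^3 * (ν^2)^3 * ν^10 * ν^20 := by gcongr
      _ = 1 * ν^40 := by ring
  have hbig : (10000:ℝ) ≤ ν^8 := by
    calc (10000:ℝ) ≤ 10000^8 := by norm_num
      _ ≤ _ := by gcongr
  have h1ν : 1/ν^20 ≤ 1/10000 := by
    apply one_div_le_one_div_of_le (by norm_num)
    calc (10000:ℝ) ≤ ν^8 := hbig
      _ ≤ ν^20 := by apply pow_le_pow_right₀ (by linarith); norm_num
  have hq1 : q ≤ 1 := by
    have : 2/ν^20 = 2*(1/ν^20) := by ring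
    linarith
  have hQ : (v:ℝ)^4 * (q+b) ≤ 1/4 := by
    have h3 : q + b ≤ 3/ν^20 := by
      calc q + b ≤ 2/ν^20 + 1/ν^20 := add_le_add hqν hbν
        _ = _ := by ring
    calc (v:ℝ)^4 * (q+b) ≤ (ν^3)^4 * (3/ν^20) := by gcongr
      _ = 3/ν^8 := by field_simp; 
      _ ≤ 3/10000 := by gcongr
      _ ≤ _ := by norm_num
  have hvn : v^3 ≤ n := by
    have : (v:ℝ)^3 ≤ n := by
      rw [hn]
      calc (v:ℝ)^3 ≤ (ν^3)^3 := by gcongr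
        _ = ν^9 := by ring
        _ ≤ ν^40 := by apply pow_le_pow_right₀ (by linarith); norm_num
    exact_mod_cast this
  have hγ : (q+b)/b^2 * (v:ℝ)^2 ≤ n := by
    have e1 : (q+b)/b^2 * (v:ℝ)^2 = q * v^2/b^2 + v^2/b := by field_simp
    rw [e1]
    have h1 : q * v^2/b^2 ≤ n/2 := by
      rw [div_le_iff₀ (by positivity)]
      have hs1 : (1:ℝ) ≤ s^6 := one_le_pow₀ (by linarith)
      calc q * (v:ℝ)^2 ≤ (2*d/n) * v^2 := by gcongr
        _ = 2*r^2*v^2/n * 1 := by rw [← hrd]; ring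
        _ ≤ 2*r^2*v^2/n * (25000000 * s^6) := by gcongr; linarith
        _ = n/2*b^2 := by rw [hb]; field_simp; ring
    have h2 : (v:ℝ)^2/b ≤ n/2 := by
      rw [div_le_iff₀ hb0]
      have hs1 : (1:ℝ) ≤ s^2 := one_le_pow₀ (by linarith)
      calc (v:ℝ)^2 = v * v * 1 := by ring
        _ ≤ v * (s*r) * (5000 * s^2) := by gcongr; linarith
        _ = n/2*b := by rw [hb]; field_simp; ring
    linarith
  have hsm := second_moment (n := n) (d := d) (k := k) (Z := (regularGraphs n d).card) (Nat.cast_nonneg _) hq0 hq1 hb0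
    (by linarith) hv2 hvn
    (fun H hH hL => key hν hn hr1 hrν hrd (by linarith) hsν hv2 hvs hvν hq hb H hH hL) hQ hγ
  have hη : k*b ≤ 10000 * v / (s^40*l) := by
    calc k * b ≤ n / (r * s^43 * l) * b := by gcongr
      _ = _ := by rw [hb]; field_simp
  have h40 : (2:ℝ)^40 ≤ s^40 := by gcongr
  have h39 : (2:ℝ)^39 ≤ s^39 := by gcongr
  have hη1 : k*b ≤ 1/100 := by
    refine hη.trans ?_
    rw [div_le_div_iff₀ (by positivity) (by norm_num)]
    calc 10000 * (v:ℝ) * 100 ≤ 10000 * (s*l) * 100 := by gcongr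
      _ = s*l*1000000 := by ring
      _ ≤ s*l*s^39 := by gcongr; exact le_trans (by norm_num) h39
      _ = _ := by ring
  have hη2 : k*b ≤ v / (10^6*l) := by
    refine hη.trans ?_
    rw [div_le_div_iff₀ (by positivity) (by positivity)]
    calc 10000 * (v:ℝ) * (10^6*l) = v*l*10^10 := by ring
      _ ≤ v*l*s^40 := by gcongr; exact le_trans (by norm_num) h40
      _ = _ := by ring
  have ht := term_bound hv2 hl (by positivity) hη1 hη2
  calc _ ≤ (regularGraphs n d).card * (8 * k^2 * 81^v * (k*b)^(2*(v-1))) * 2^v := by gcongr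
    _ = ((regularGraphs n d).card * k^2) * (2^v * (8 * 81^v * (k*b)^(2*(v-1)))) := by ring
    _ ≤ _ := by gcongr

lemma ex_mono {n d : ℕ} {φ ψ : Graph n → ℝ} (h : ∀ G, φ G ≤ ψ G) : ex n d φ ≤ ex n d ψ :=
  Finset.sum_le_sum fun G _ => h G

lemma total {n d D : ℕ} {q r s ν k l : ℝ} (hν : 10000 ≤ ν) (hn : (n:ℝ) = ν^40)
    (hr1 : 1 ≤ r) (hrν : r ≤ ν^10) (hrd : r^2 = d) (hs2 : 2 ≤ s) (hsν : s ≤ ν^2)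
    (hvs : (D:ℝ) ≤ s*r) (hvν : (D:ℝ) ≤ ν^3) (hq : q*((n:ℝ)-d) = d)
    (hl : 0 < l) (hvl : (D:ℝ) ≤ s*l) (hk0 : 0 < k) (hk : k ≤ n / (r * s^43 * l)) :
    ex n d (fun G => (∑ v ∈ Finset.Icc 2 D, Xv n q (k/n) v G)^2) ≤ (regularGraphs n d).card * (k^2 / l^2) := by
  refine (ex_mono fun G => cs D (fun v => Xv n q (k/n) v G)).trans ?_
  rw [ex_mul, ex_sum]
  have h : ∀ v ∈ Finset.Icc 2 D, ex n d (fun G => 2^v * (Xv n q (k/n) v G)^2) ≤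
      (((regularGraphs n d).card * k^2) * (1/(4*l^2))) * (1/2)^v := by
    intro v hv
    rw [Finset.mem_Icc] at hv
    have hvD : (v:ℝ) ≤ D := by exact_mod_cast hv.2
    rw [ex_mul, mul_comm]
    refine (sm_v hν hn hr1 hrν hrd hs2 hsν hv.1 (hvD.trans hvs) (hvD.trans hvν) hq hl (hvD.trans hvl) hk0 hk).trans (le_of_eq ?_)
    ring
  have h2 := Finset.sum_le_sum h
  rw [← Finset.mul_sum] at h2
  have h3 := mul_le_mul_of_nonneg_left (geo_le D) (show 0 ≤ (((regularGraphs n d).card * k^2) * (1/(4*l^2))) by positivity)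
  calc _ ≤ 2 * ((((regularGraphs n d).card * k^2) * (1/(4*l^2))) * 2) := by linarith
    _ = _ := by field_simp; ring

lemma cheb {n d : ℕ} {Y : Graph n → ℝ} {k l ε : ℝ} (hk : 0 < k) (hl : 0 < l) (hε : 0 < ε)
    (hlε : 1 ≤ ε^3 * l^2) (hne : (regularGraphs n d).Nonempty)
    (h : ex n d (fun G => (Y G)^2) ≤ (regularGraphs n d).card * (k^2 / l^2)) :
    1 - ε ≤ regPr n d (fun G => (1-ε)*k ≤ k + Y G) := by
  have hZ : (0:ℝ) < (regularGraphs n d).card := by exact_mod_cast hne.card_pos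
  unfold regPr
  rw [le_div_iff₀ hZ]
  have hs := Finset.card_filter_add_card_filter_not (s := regularGraphs n d) (fun G => (1-ε)*k ≤ k + Y G)
  have hs' : (((regularGraphs n d).filter (fun G => (1-ε)*k ≤ k + Y G)).card : ℝ) +
    ((regularGraphs n d).filter (fun G => ¬ (1-ε)*k ≤ k + Y G)).card = (regularGraphs n d).card := by exact_mod_cast hs
  set B := (regularGraphs n d).filter (fun G => ¬ (1-ε)*k ≤ k + Y G) with hB
  have h1 : (B.card : ℝ) * (ε*k)^2 ≤ ex n d (fun G => (Y G)^2) := by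
    calc (B.card : ℝ) * (ε*k)^2 = ∑ G ∈ B, (ε*k)^2 := by simp
      _ ≤ ∑ G ∈ B, (Y G)^2 := by
        apply Finset.sum_le_sum
        intro G hG
        have := (Finset.mem_filter.1 hG).2
        have hek : 0 < ε*k := by positivity
        nlinarith
      _ ≤ _ := Finset.sum_le_sum_of_subset_of_nonneg (Finset.filter_subset _ _) (fun _ _ _ => sq_nonneg _)
  have h2 : (B.card : ℝ) * (ε*k)^2 ≤ (regularGraphs n d).card * (k^2 / l^2) := h1.trans h
  have h3 : (B.card : ℝ) ≤ ε * (regularGraphs n d).card := by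
    have h4 : (B.card : ℝ) * (ε*k)^2 ≤ (ε * (regularGraphs n d).card) * (ε*k)^2 := by
      refine h2.trans ?_
      have : k^2/l^2 ≤ k^2 * ε^3 := by
        rw [div_le_iff₀ (by positivity)]; nlinarith [sq_nonneg k]
      calc _ ≤ (regularGraphs n d).card * (k^2 * ε^3) := by gcongr
        _ = _ := by ring
    exact le_of_mul_le_mul_right h4 (by positivity)
  linarith
end GMP

namespace GMP
open GM

lemma char_fe {n : ℕ} {p : ℝ} (hp0 : 0 < p) (hp1 : p < 1) (G : Graph n) (e : Sym2 (Fin n)) :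
    (-Real.sqrt (p/(1-p))) * char p G e = fe (p/(1-p)) G e := by
  have h1 : 0 < 1 - p := by linarith
  unfold char fe
  split_ifs
  · rw [neg_mul, ← Real.sqrt_mul (by positivity)]
    rw [show p/(1-p) * ((1-p)/p) = 1 by field_simp]; simp
  · rw [neg_mul_neg, Real.mul_self_sqrt (by positivity)]

lemma prod_char {n : ℕ} {p : ℝ} (hp0 : 0 < p) (hp1 : p < 1) (G : Graph n) (R : Finset (Sym2 (Fin n))) :
    (-Real.sqrt (p/(1-p)))^R.card * ∏ e ∈ R, char p G e = fH (p/(1-p)) G R := by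
  unfold fH
  rw [← Finset.prod_const, ← Finset.prod_mul_distrib]
  exact Finset.prod_congr rfl fun e _ => char_fe hp0 hp1 G e

lemma reach_verts {n : ℕ} {R : Finset (Sym2 (Fin n))} {u w : Fin n}
    (h : (SimpleGraph.fromEdgeSet (R : Set (Sym2 (Fin n)))).Reachable u w) (hu : u ∈ vertsOf R) : w ∈ vertsOf R := by
  obtain ⟨p⟩ := h
  induction p with
  | nil => exact hu
  | cons hadj _ ih =>
    apply ih
    rw [SimpleGraph.fromEdgeSet_adj] at hadj
    exact (mem_verts (by exact_mod_cast hadj.1)).2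

lemma conn_iff {n : ℕ} {R : Finset (Sym2 (Fin n))} (hne : R.Nonempty) (i : Fin n) :
    ConnectedToS R {i} ↔ i ∈ vertsOf R ∧ Conn R := by
  constructor
  · intro h
    obtain ⟨e, he⟩ := hne
    induction e using Sym2.ind with
    | _ a b =>
      have ha := (mem_verts he).1
      have h' : ∀ u ∈ vertsOf R, (SimpleGraph.fromEdgeSet (R : Set (Sym2 (Fin n)))).Reachable u i := by
        intro u hu
        obtain ⟨s, hs, hr⟩ := h u hu
        rw [Finset.mem_singleton] at hs
        subst hs; exact hr
      exact ⟨reach_verts (h' a ha) ha, fun u hu w hw => (h' u hu).trans (h' w hw).symm⟩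
  · rintro ⟨hi, hc⟩ u hu
    exact ⟨i, by simp, hc u hu i hi⟩

lemma verts_empty {n : ℕ} : vertsOf (∅ : Finset (Sym2 (Fin n))) = ∅ := by
  ext; simp [vertsOf]

lemma decomp {n : ℕ} {p k : ℝ} (hp0 : 0 < p) (hp1 : p < 1) (hn : 0 < n) (D : ℕ) (hD : 1 ≤ D) (G : Graph n) :
    ∑ i : Fin n, Lam n p k D G {i} = k + ∑ v ∈ Finset.Icc 2 D, Xv n (p/(1-p)) (k/n) v G := by
  set q := p/(1-p) with hq
  have hL : ∀ i : Fin n, Lam n p k D G {i} = ∑ R : Finset (Sym2 (Fin n)),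
      if (SimpleE R ∧ ConnectedToS R {i} ∧ (vertsOf R ∪ {i}).card ≤ D) then (k/n)^(vertsOf R ∪ {i}).card * fH q G R else 0 := by
    intro i
    unfold Lam
    rw [Finset.sum_filter]
    refine Finset.sum_congr rfl fun R _ => ?_
    rw [mul_assoc, prod_char hp0 hp1]
    congr
  have hX : ∀ v, Xv n q (k/n) v G = ∑ R : Finset (Sym2 (Fin n)), if (SimpleE R ∧ Conn R ∧ (vertsOf R).card = v) then (v * (k/n)^v) * fH q G R else 0 := by
    intro v
    unfold Xv Fam
    rw [Finset.sum_filter]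
  simp_rw [hL, hX]
  rw [Finset.sum_comm, Finset.sum_comm (s := Finset.Icc 2 D)]
  have hk : k = ∑ R : Finset (Sym2 (Fin n)), if R = ∅ then k else 0 := by simp
  refine Eq.trans ?_ (congrArg (· + _) hk.symm)
  rw [← Finset.sum_add_distrib]
  refine Finset.sum_congr rfl fun R _ => ?_
  rcases R.eq_empty_or_nonempty with rfl | hne
  · have h1 : ∀ i : Fin n, (SimpleE (∅ : Finset (Sym2 (Fin n))) ∧ ConnectedToS (∅ : Finset (Sym2 (Fin n))) {i} ∧ (vertsOf (∅ : Finset (Sym2 (Fin n))) ∪ {i}).card ≤ D) := by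
      intro i
      refine ⟨by intro e he; simp at he, ?_, ?_⟩
      · intro v hv; rw [verts_empty] at hv; simp at hv
      · rw [verts_empty]; simpa using hD
    rw [Finset.sum_congr rfl (fun i _ => if_pos (h1 i))]
    have h2 : ∀ v ∈ Finset.Icc 2 D, (if (SimpleE (∅ : Finset (Sym2 (Fin n))) ∧ Conn (∅ : Finset (Sym2 (Fin n))) ∧ (vertsOf (∅ : Finset (Sym2 (Fin n)))).card = v) then (v * (k/n)^v) * fH q G ∅ else 0) = 0 := by
      intro v hv
      rw [Finset.mem_Icc] at hv
      rw [if_neg]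
      rintro ⟨_, _, h⟩
      rw [verts_empty] at h; simp at h; omega
    rw [Finset.sum_eq_zero h2]
    have hn' : (n:ℝ) ≠ 0 := by positivity
    simp [verts_empty, fH]
    field_simp
  · rw [if_neg hne.ne_empty, zero_add]
    by_cases hs : SimpleE R ∧ Conn R ∧ (vertsOf R).card ≤ D
    · have h2 : 2 ≤ (vertsOf R).card := by
        have := simple_card hs.1
        have h3 := hne.card_pos
        by_contra hlt
        have : (vertsOf R).card ≤ 1 := by omega
        have : (vertsOf R).card ^ 2 ≤ 1 ^ 2 := Nat.pow_le_pow_left this 2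
        omega
      rw [Finset.sum_eq_single (vertsOf R).card]
      · rw [if_pos ⟨hs.1, hs.2.1, rfl⟩]
        have h4 : ∀ i : Fin n, (if (SimpleE R ∧ ConnectedToS R {i} ∧ (vertsOf R ∪ {i}).card ≤ D) then (k/n)^(vertsOf R ∪ {i}).card * fH q G R else 0)
          = if i ∈ vertsOf R then (k/n)^(vertsOf R).card * fH q G R else 0 := by
          intro i
          by_cases hi : i ∈ vertsOf R
          · have : vertsOf R ∪ {i} = vertsOf R := by simpa using hi
            rw [this, if_pos hi, if_pos ⟨hs.1, (conn_iff hne i).2 ⟨hi, hs.2.1⟩, hs.2.2⟩]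
          · rw [if_neg hi, if_neg]
            rintro ⟨_, h, _⟩
            exact hi ((conn_iff hne i).1 h).1
        rw [Finset.sum_congr rfl (fun i _ => h4 i), ← Finset.sum_filter]
        simp
        ring
      · intro v _ hv
        rw [if_neg]
        rintro ⟨_, _, h⟩; exact hv h.symm
      · intro h
        exact absurd (Finset.mem_Icc.2 ⟨h2, hs.2.2⟩) h
    · rw [Finset.sum_eq_zero, Finset.sum_eq_zero]
      · intro v hv
        rw [if_neg]
        rintro ⟨h1, h2, h3⟩
        exact hs ⟨h1, h2, by rw [h3]; exact (Finset.mem_Icc.1 hv).2⟩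
      · intro i _
        rw [if_neg]
        rintro ⟨h1, h2, h3⟩
        refine hs ⟨h1, ((conn_iff hne i).1 h2).2, le_trans (Finset.card_le_card Finset.subset_union_left) h3⟩
end GMP

namespace GMP
open GM

lemma neg_val {m : ℕ} (x : Fin (m+1)) (hx : x.val ≠ 0) : (-x).val = m + 1 - x.val := by
  rw [Fin.val_neg']
  apply Nat.mod_eq_of_lt
  omega

lemma sym_set (m d : ℕ) (hd : d < m+1) (hev : Even ((m+1) * d)) :
    ∃ S : Finset (Fin (m+1)), (0 : Fin (m+1)) ∉ S ∧ (∀ x, x ∈ S → -x ∈ S) ∧ S.card = d := by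
  set h := d/2 with hh
  set P : ℕ → Prop := fun x => (1 ≤ x ∧ x ≤ h) ∨ (m+1-h ≤ x) ∨ (d = 2*h+1 ∧ 2*x = m+1) with hP
  refine ⟨Finset.univ.filter (fun x => P x.val), ?_, ?_, ?_⟩
  · simp [hP]; omega
  · intro x
    simp only [Finset.mem_filter, Finset.mem_univ, true_and]
    intro hx
    have hx0 : x.val ≠ 0 := by
      intro h0; rw [h0] at hx; simp only [hP] at hx; omega
    rw [neg_val x hx0]
    simp only [hP] at hx ⊢
    have := x.isLt
    omega
  · rw [← Finset.card_map Fin.valEmbedding]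
    have key : (Finset.univ.filter (fun x : Fin (m+1) => P x.val)).map Fin.valEmbedding = (Finset.range (m+1)).filter P := by
      ext y
      simp only [Finset.mem_map, Finset.mem_filter, Finset.mem_univ, true_and, Finset.mem_range, Fin.valEmbedding_apply]
      constructor
      · rintro ⟨x, hx, rfl⟩; exact ⟨x.isLt, hx⟩
      · rintro ⟨h1, h2⟩; exact ⟨⟨y, h1⟩, h2, rfl⟩
    rw [key]
    rcases Nat.even_or_odd' d with ⟨c, hc | hc⟩
    · have : (Finset.range (m+1)).filter P = Finset.Icc 1 h ∪ Finset.Ico (m+1-h) (m+1) := by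
        ext y; simp only [hP, Finset.mem_filter, Finset.mem_range, Finset.mem_union, Finset.mem_Icc, Finset.mem_Ico]; omega
      rw [this, Finset.card_union_of_disjoint]
      · simp; omega
      · rw [Finset.disjoint_left]; intro y; simp only [Finset.mem_Icc, Finset.mem_Ico]; omega
    · have hm : Even (m+1) := by
        rcases Nat.even_mul.1 hev with h1 | h1
        · exact h1
        · exfalso; obtain ⟨t, ht⟩ := h1; omega
      obtain ⟨t, ht⟩ := hm
      have : (Finset.range (m+1)).filter P = Finset.Icc 1 h ∪ (Finset.Ico (m+1-h) (m+1) ∪ {t}) := by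
        ext y; simp only [hP, Finset.mem_filter, Finset.mem_range, Finset.mem_union, Finset.mem_Icc, Finset.mem_Ico, Finset.mem_singleton]; omega
      rw [this, Finset.card_union_of_disjoint, Finset.card_union_of_disjoint]
      · simp; omega
      · rw [Finset.disjoint_left]; intro y; simp only [Finset.mem_Ico, Finset.mem_singleton]; omega
      · rw [Finset.disjoint_left]; intro y; simp only [Finset.mem_Icc, Finset.mem_Ico, Finset.mem_union, Finset.mem_singleton]; omega

lemma reg_nonempty (n d : ℕ) (hd : d < n) (hev : Even (n * d)) : (regularGraphs n d).Nonempty := by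
  obtain ⟨m, rfl⟩ : ∃ m, n = m + 1 := ⟨n-1, by omega⟩
  obtain ⟨S, h0, hneg, hcard⟩ := sym_set m d hd hev
  set G : Graph (m+1) := Finset.univ.filter (fun e => ∃ a b, e = s(a,b) ∧ b - a ∈ S) with hG
  have hadj : ∀ u w, s(u,w) ∈ G ↔ w - u ∈ S := by
    intro u w
    simp only [hG, Finset.mem_filter, Finset.mem_univ, true_and]
    constructor
    · rintro ⟨a, b, hab, h⟩
      rcases Sym2.eq_iff.1 hab with ⟨rfl, rfl⟩ | ⟨rfl, rfl⟩
      · exact h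
      · have := hneg _ h; rwa [neg_sub] at this
    · intro h; exact ⟨u, w, rfl, h⟩
  have hsimple : IsSimpleG G := by
    intro e he
    induction e using Sym2.ind with
    | _ a b =>
      intro hdiag
      rw [Sym2.mk_isDiag_iff] at hdiag
      subst hdiag
      rw [hadj, sub_self] at he
      exact h0 he
  refine ⟨G, mem_reg.2 ⟨hsimple, fun u => ?_⟩⟩
  rw [← card_nbr, ← hcard]
  apply Finset.card_bij (fun w _ => w - u)
  · intro w hw; exact (hadj u w).1 (Finset.mem_filter.1 hw).2
  · intro a _ b _ h; exact sub_left_injective h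
  · intro x hx
    exact ⟨x + u, Finset.mem_filter.2 ⟨Finset.mem_univ _, (hadj _ _).2 (by simpa using hx)⟩, by simp⟩
end GMP

namespace GMP
open GM

lemma main_aux {n d dsos : ℕ} {ε k : ℝ} (hε : 0 < ε) (hν : 10000 ≤ (n:ℝ)^(1/40:ℝ))
    (hlν : Real.log n ≤ (n:ℝ)^(1/40:ℝ)) (hl4 : 4 ≤ Real.log n) (hlε : 1 ≤ ε^3 * (Real.log n)^2)
    (hd1 : Real.log n ^ 2 ≤ (d : ℝ)) (hd2 : (d : ℝ) ≤ (n : ℝ) ^ (1 / 2 : ℝ)) (hev : Even (n * d))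
    (hs2 : 2 ≤ dsos) (hsd : (dsos : ℝ) ≤ (d : ℝ) ^ (1 / 10 : ℝ)) (hk0 : 0 < k)
    (hk : k ≤ (n : ℝ) / (Real.sqrt d * (dsos : ℝ) ^ (43:ℝ) * Real.log n)) :
    1 - ε ≤ regPr n d (fun G =>
          (1 - ε) * k ≤ ∑ i : Fin n,
            Lam n ((d : ℝ) / n) k ⌈(1/2:ℝ) * dsos * Real.log n⌉₊ G {i}) := by
  set l := Real.log n with hl
  set ν := (n:ℝ)^(1/40:ℝ) with hνd
  set r := Real.sqrt d with hr
  set s : ℝ := (dsos : ℝ) with hs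
  set D := ⌈(1/2:ℝ) * s * l⌉₊ with hD
  have hn : (n:ℝ) = ν^40 := by
    rw [hνd, ← Real.rpow_natCast, ← Real.rpow_mul (Nat.cast_nonneg n)]; norm_num
  have hν0 : 0 < ν := by linarith
  have hn0 : (0:ℝ) < n := by rw [hn]; positivity
  have hd20 : (d:ℝ) ≤ ν^20 := by
    refine hd2.trans (le_of_eq ?_)
    rw [hνd, ← Real.rpow_natCast, ← Real.rpow_mul (Nat.cast_nonneg n)]; norm_num
  have hd0 : (0:ℝ) < d := by nlinarith
  have hrd : r^2 = d := Real.sq_sqrt hd0.le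
  have hlr : l ≤ r := Real.le_sqrt_of_sq_le hd1
  have hrν : r ≤ ν^10 := by
    apply Real.sqrt_le_iff.2 ⟨by positivity, ?_⟩
    refine hd20.trans (le_of_eq (by ring))
  have hs2' : (2:ℝ) ≤ s := by rw [hs]; exact_mod_cast hs2
  have hsν : s ≤ ν^2 := by
    refine hsd.trans ((Real.rpow_le_rpow hd0.le hd20 (by norm_num)).trans (le_of_eq ?_))
    rw [← Real.rpow_natCast, ← Real.rpow_mul hν0.le, ← Real.rpow_natCast]; norm_num
  have hDl : (D:ℝ) ≤ s*l := by
    have h1 : (D:ℝ) < (1/2:ℝ)*s*l + 1 := Nat.ceil_lt_add_one (by positivity)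
    nlinarith
  have hD1 : 1 ≤ D := Nat.ceil_pos.2 (by positivity)
  have hdn : (d:ℝ) < n := by
    rw [hn]; refine hd20.trans_lt (pow_lt_pow_right₀ (by linarith) (by norm_num))
  have hnd : 0 < (n:ℝ) - d := by linarith
  set p : ℝ := (d:ℝ)/n with hp
  have hp0 : 0 < p := by positivity
  have hp1 : p < 1 := by rw [hp, div_lt_one hn0]; exact hdn
  have hq : p/(1-p) * ((n:ℝ)-d) = d := by
    have : 1 - p = ((n:ℝ)-d)/n := by rw [hp]; field_simp
    rw [this, hp]; field_simp
  have hk' : k ≤ n / (r * s^43 * l) := by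
    refine hk.trans (le_of_eq ?_)
    congr 3
    rw [← Real.rpow_natCast]; norm_num
  have htot := total (n := n) (d := d) (D := D) (q := p/(1-p)) (r := r) (s := s) (ν := ν) (k := k) (l := l)
    hν hn (by linarith) hrν hrd hs2' hsν (hDl.trans (by gcongr))
    (hDl.trans (by calc s*l ≤ ν^2*ν := by gcongr
                    _ = ν^3 := by ring)) hq (by linarith) hDl hk0 hk'
  have hne := reg_nonempty n d (by exact_mod_cast hdn) hev
  have hc := cheb (Y := fun G => ∑ v ∈ Finset.Icc 2 D, Xv n (p/(1-p)) (k/n) v G) hk0 (by linarith) hε hlε hne htot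
  have hfun : (fun G => (1 - ε) * k ≤ ∑ i : Fin n, Lam n p k D G {i}) =
      (fun G => (1 - ε) * k ≤ k + ∑ v ∈ Finset.Icc 2 D, Xv n (p/(1-p)) (k/n) v G) := by
    funext G
    rw [decomp hp0 hp1 (by exact_mod_cast hn0) D hD1 G]
  rw [hfun]
  exact hc

lemma main_ev {ε : ℝ} (hε : 0 < ε) : ∃ n₀ : ℕ, ∀ n : ℕ, n₀ ≤ n →
    10000 ≤ (n:ℝ)^(1/40:ℝ) ∧ Real.log n ≤ (n:ℝ)^(1/40:ℝ) ∧ 4 ≤ Real.log n ∧ 1 ≤ ε^3 * (Real.log n)^2 := by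
  have hc : Filter.Tendsto (fun n : ℕ => (n:ℝ)) Filter.atTop Filter.atTop := tendsto_natCast_atTop_atTop
  have h1 := ((tendsto_rpow_atTop (show (0:ℝ) < 1/40 by norm_num)).comp hc).eventually_ge_atTop 10000
  have h2 := hc.eventually ((isLittleO_log_rpow_atTop (show (0:ℝ) < 1/40 by norm_num)).bound (show (0:ℝ) < 1 by norm_num))
  have h3 := (Real.tendsto_log_atTop.comp hc).eventually_ge_atTop 4
  have h4 := (Real.tendsto_log_atTop.comp hc).eventually_ge_atTop (1/ε^3)
  obtain ⟨n₀, hn₀⟩ := Filter.eventually_atTop.1 (h1.and (h2.and (h3.and h4)))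
  refine ⟨n₀, fun n hn => ?_⟩
  obtain ⟨a1, a2, a3, a4⟩ := hn₀ n hn
  simp only [Function.comp] at a1 a2 a3 a4
  have hε3 : 0 < ε^3 := by positivity
  refine ⟨a1, ?_, a3, ?_⟩
  · rw [one_mul, Real.norm_eq_abs, Real.norm_eq_abs, abs_of_nonneg (by positivity : (0:ℝ) ≤ (n:ℝ)^(1/40:ℝ))] at a2
    exact (le_abs_self _).trans a2
  · rw [div_le_iff₀ hε3] at a4
    nlinarith
end GMP

open GM in
/-- With high probability over a uniformly random `d`-regular graph, the pseudo-calibrated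
pseudo-expectation attains objective value `Σᵢ Ẽ[xᵢ] ≥ (1-ε)k`. -/
theorem pseudo_calibration_large_value_regular :
    ∃ c C : ℝ, 0 < c ∧ 0 < C ∧
      ∀ ε : ℝ, 0 < ε → ∃ n₀ : ℕ, ∀ n : ℕ, n₀ ≤ n → ∀ d : ℕ,
        Real.log n ^ 2 ≤ (d : ℝ) → (d : ℝ) ≤ (n : ℝ) ^ (1 / 2 : ℝ) → Even (n * d) →
        ∀ dsos : ℕ, 2 ≤ dsos → (dsos : ℝ) ≤ (d : ℝ) ^ (1 / 10 : ℝ) →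
        ∀ k : ℝ, 0 < k → k ≤ (n : ℝ) / (Real.sqrt d * (dsos : ℝ) ^ c * Real.log n) →
        1 - ε ≤ regPr n d (fun G =>
          (1 - ε) * k ≤ ∑ i : Fin n,
            Lam n ((d : ℝ) / n) k ⌈C * dsos * Real.log n⌉₊ G {i}) := by
  refine ⟨43, 1/2, by norm_num, by norm_num, fun ε hε => ?_⟩
  obtain ⟨n₀, h⟩ := GMP.main_ev hε
  refine ⟨n₀, fun n hn d hd1 hd2 hev dsos hs2 hsd k hk0 hk => ?_⟩
  obtain ⟨a1, a2, a3, a4⟩ := h n hn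
  exact GMP.main_aux hε a1 a2 a3 a4 hd1 hd2 hev hs2 hsd hk0 hk
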